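/- Let β⃗ be sub-critical and X ~ ERGM(β⃗) on 𝒢_n. For any fixed integers l, m ≥ 0 and fixed integers a_1,…,a_m ≥ 1 with a_1 + ⋯ + a_m ≤ 2m, there exists a constant C = C(l,a_1,…,a_m) > 0 such that for all sufficiently large n and any edges i_1,…,i_m, j_1,…,j_l of K_n no two of which share a vertex, almost surely |𝔼[(X_{i_1} − 𝔼 X_{i_1})^{a_1} ⋯ (X_{i_m} − 𝔼 X_{i_m})^{a_m} | X_{j_1},…,X_{j_l}]| ≤ C / n^{m − (a_1+⋯+a_m)/2}. -/

import Mathlib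

open Finset MeasureTheory Filter
open scoped ENNReal NNReal

namespace ERGM

/-- The set of edges of the complete graph on `Fin n`: non-diagonal unordered pairs. -/
abbrev EdgeSet (n : ℕ) : Type := {p : Sym2 (Fin n) // ¬ p.IsDiag}

/-- A configuration (graph on `n` vertices): an assignment of `true/false` to each edge. -/
abbrev Config (n : ℕ) : Type := EdgeSet n → Bool

/-- The value of the configuration `x` on the (unordered) pair `{i,j}`; `false` for `i = j`. -/
noncomputable def edgeVal {n : ℕ} (x : Config n) (i j : Fin n) : Bool :=
  if h : (s(i, j) : Sym2 (Fin n)).IsDiag then false else x ⟨s(i, j), h⟩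

/-- Real-valued indicator of presence of the edge `{i,j}` in `x`. -/
noncomputable def edgeInd {n : ℕ} (x : Config n) (i j : Fin n) : ℝ :=
  if edgeVal x i j = true then 1 else 0

open scoped Classical in
/-- Subgraph counting number `N_G(x)`: the number of copies of `G` in `x` (times the
number of automorphisms), i.e. the sum over injective `ψ` of the product of edge
indicators (each edge indicator is idempotent, so counting ordered adjacent pairs
yields the same value as counting edges). -/
noncomputable def NG {n m : ℕ} (G : SimpleGraph (Fin m)) (x : Config n) : ℝ :=
  ∑ ψ : Fin m ↪ Fin n, ∏ a : Fin m, ∏ b : Fin m,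
    if G.Adj a b then edgeInd x (ψ a) (ψ b) else 1

/-- The Hamiltonian `H(x) = Σ_i β_i N_{G_i}(x) / n^{|V_i|-2}`. -/
noncomputable def Hamiltonian {n s : ℕ} (V : Fin s → ℕ)
    (G : ∀ i, SimpleGraph (Fin (V i))) (β : Fin s → ℝ) (x : Config n) : ℝ :=
  ∑ i, β i * NG (G i) x / (n : ℝ) ^ (V i - 2)

/-- The ERGM probability mass function `π(x) ∝ exp(H(x))`. -/
noncomputable def ergmProb {n s : ℕ} (V : Fin s → ℕ)
    (G : ∀ i, SimpleGraph (Fin (V i))) (β : Fin s → ℝ) (x : Config n) : ℝ :=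
  Real.exp (Hamiltonian V G β x) / ∑ y : Config n, Real.exp (Hamiltonian V G β y)

/-- Expectation of `f` with respect to the mass function `w`. -/
noncomputable def expect {n : ℕ} (w : Config n → ℝ) (f : Config n → ℝ) : ℝ :=
  ∑ x : Config n, w x * f x

open scoped Classical in
/-- Probability of the event `A` with respect to the mass function `w`. -/
noncomputable def prob {n : ℕ} (w : Config n → ℝ) (A : Config n → Prop) : ℝ :=
  ∑ x : Config n, if A x then w x else 0

/-- The number of edges `|E(G)|` of a finite graph. -/
noncomputable def numEdges {m : ℕ} (G : SimpleGraph (Fin m)) : ℕ := G.edgeSet.ncard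

/-- `Ψ_β(p) = Σ_i 2 β_i |E_i| p^{|E_i|-1}`. -/
noncomputable def Psi {s : ℕ} (V : Fin s → ℕ) (G : ∀ i, SimpleGraph (Fin (V i)))
    (β : Fin s → ℝ) (p : ℝ) : ℝ :=
  ∑ i, 2 * β i * (numEdges (G i) : ℝ) * p ^ (numEdges (G i) - 1)

/-- `Φ(u) = e^u / (1 + e^u)`. -/
noncomputable def Phi (u : ℝ) : ℝ := Real.exp u / (1 + Real.exp u)

/-- `φ_β(p) = Φ(Ψ_β(p))`. -/
noncomputable def phiFn {s : ℕ} (V : Fin s → ℕ) (G : ∀ i, SimpleGraph (Fin (V i)))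
    (β : Fin s → ℝ) : ℝ → ℝ := fun p => Phi (Psi V G β p)

/-- `β` is sub-critical (high temperature) with fixed point `p`: `p` is the unique
solution of `φ_β(p) = p` and it satisfies `φ_β'(p) < 1`. -/
def Subcritical {s : ℕ} (V : Fin s → ℕ) (G : ∀ i, SimpleGraph (Fin (V i)))
    (β : Fin s → ℝ) (p : ℝ) : Prop :=
  phiFn V G β p = p ∧ (∀ q : ℝ, phiFn V G β q = q → q = p) ∧
    deriv (phiFn V G β) p < 1

/-- The discrete derivative `∂_e H(x) = H(x_{e+}) - H(x_{e-})`. -/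
noncomputable def dHam {n s : ℕ} (V : Fin s → ℕ) (G : ∀ i, SimpleGraph (Fin (V i)))
    (β : Fin s → ℝ) (e : EdgeSet n) (x : Config n) : ℝ :=
  Hamiltonian V G β (Function.update x e true) - Hamiltonian V G β (Function.update x e false)

/-- Real-valued indicator `X_e` of presence of edge `e`. -/
noncomputable def edgeX {n : ℕ} (e : EdgeSet n) (x : Config n) : ℝ := if x e = true then 1 else 0

/-- Two edges of `K_n` share a vertex. -/
def ShareVertex {n : ℕ} (e f : EdgeSet n) : Prop := ∃ v : Fin n, v ∈ e.1 ∧ v ∈ f.1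


open scoped Classical in
/-- Conditional expectation `𝔼[f | ∀ t, X_{j_t} = b_t]` under the mass function `w`. -/
noncomputable def condExpect {n l : ℕ} (w : Config n → ℝ) (f : Config n → ℝ)
    (j : Fin l → EdgeSet n) (b : Fin l → Bool) : ℝ :=
  (∑ x : Config n, if (∀ t, x (j t) = b t) then w x * f x else 0) /
    prob w (fun x => ∀ t, x (j t) = b t)

section Operators

variable {E : Type*}

/-- The indicator `1` or `0` of a Boolean. -/
noncomputable def ind (b : Bool) : ℝ := if b = true then 1 else 0

lemma ind_true : ind true = 1 := by simp [ind]

lemma ind_false : ind false = 0 := by simp [ind]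

lemma ind_nonneg (b : Bool) : 0 ≤ ind b := by cases b <;> simp [ind]

lemma ind_le_one (b : Bool) : ind b ≤ 1 := by cases b <;> simp [ind]

lemma ind_mono {b c : Bool} (h : b ≤ c) : ind b ≤ ind c := by
  revert h; cases b <;> cases c <;> simp [ind]

/-- The monomial `∏_{f ∈ T} x_f`. -/
noncomputable def mon (T : Finset E) (x : E → Bool) : ℝ := ∏ f ∈ T, ind (x f)

lemma mon_nonneg (T : Finset E) (x : E → Bool) : 0 ≤ mon T x :=
  Finset.prod_nonneg fun _ _ => ind_nonneg _

lemma mon_le_one (T : Finset E) (x : E → Bool) : mon T x ≤ 1 :=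
  Finset.prod_le_one (fun _ _ => ind_nonneg _) fun _ _ => ind_le_one _

lemma mon_mono (T : Finset E) {x y : E → Bool} (h : x ≤ y) : mon T x ≤ mon T y :=
  Finset.prod_le_prod (fun _ _ => ind_nonneg _) fun f _ => ind_mono (h f)

lemma mon_eq_ite (T : Finset E) (x : E → Bool) :
    mon T x = if ∀ f ∈ T, x f = true then 1 else 0 := by
  unfold mon ind
  rw [Finset.prod_ite_zero]
  simp

lemma mon_supermodular (T : Finset E) (x y : E → Bool) :
    mon T x + mon T y ≤ mon T (x ⊓ y) + mon T (x ⊔ y) := by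
  by_cases hx : ∀ f ∈ T, x f = true
  · have h1 : mon T (x ⊓ y) = mon T y :=
      Finset.prod_congr rfl fun f hf => by simp [hx f hf]
    have h2 : mon T (x ⊔ y) = mon T x :=
      Finset.prod_congr rfl fun f hf => by simp [hx f hf]
    linarith
  · have : mon T x = 0 := by rw [mon_eq_ite, if_neg hx]
    linarith [mon_nonneg T (x ⊓ y), mon_mono T (le_sup_right : y ≤ x ⊔ y)]

variable [DecidableEq E]

/-- Setting a coordinate is monotone. -/
lemma update_mono {x y : E → Bool} (h : x ≤ y) (e : E) (b : Bool) :
    Function.update x e b ≤ Function.update y e b := by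
  intro f
  by_cases hf : f = e
  · subst hf; simp
  · simpa [hf] using h f

lemma update_false_le_true (x : E → Bool) (e : E) :
    Function.update x e false ≤ Function.update x e true := by
  intro f
  by_cases hf : f = e
  · subst hf; simp
  · simp [hf]

/-- Resample the coordinate `e` as a Bernoulli variable with parameter `q`. -/
noncomputable def resample (q : ℝ) (e : E) (F : (E → Bool) → ℝ) (x : E → Bool) : ℝ :=
  q * F (Function.update x e true) + (1 - q) * F (Function.update x e false)

/-- Resample all the coordinates in a list. -/
noncomputable def resampleList (q : ℝ) (l : List E) (F : (E → Bool) → ℝ) : (E → Bool) → ℝ :=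
  l.foldr (resample q) F

@[simp] lemma resampleList_nil (q : ℝ) (F : (E → Bool) → ℝ) : resampleList q [] F = F := rfl

@[simp] lemma resampleList_cons (q : ℝ) (e : E) (l : List E) (F : (E → Bool) → ℝ) :
    resampleList q (e :: l) F = resample q e (resampleList q l F) := rfl

lemma resample_mono {q : ℝ} (h0 : 0 ≤ q) (h1 : q ≤ 1) (e : E) {F G : (E → Bool) → ℝ}
    (h : ∀ x, F x ≤ G x) (x : E → Bool) : resample q e F x ≤ resample q e G x := by
  unfold resample
  have := sub_nonneg.2 h1
  gcongr <;> exact h _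

lemma resampleList_mono {q : ℝ} (h0 : 0 ≤ q) (h1 : q ≤ 1) (l : List E)
    {F G : (E → Bool) → ℝ} (h : ∀ x, F x ≤ G x) (x : E → Bool) :
    resampleList q l F x ≤ resampleList q l G x := by
  induction l generalizing x with
  | nil => exact h x
  | cons e l ih => exact resample_mono h0 h1 e ih x

lemma resample_const (q : ℝ) (e : E) (c : ℝ) : resample q e (fun _ => c) = fun _ => c := by
  funext x; unfold resample; ring

lemma resampleList_const (q : ℝ) (l : List E) (c : ℝ) :
    resampleList q l (fun _ => c) = fun _ => c := by
  induction l with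
  | nil => rfl
  | cons e l ih => rw [resampleList_cons, ih, resample_const]

lemma resampleList_const_mul (q : ℝ) (l : List E) (c : ℝ) (F : (E → Bool) → ℝ) :
    resampleList q l (fun x => c * F x) = fun x => c * resampleList q l F x := by
  induction l with
  | nil => rfl
  | cons e l ih =>
    rw [resampleList_cons, ih]
    funext x; simp only [resample, resampleList_cons]; ring

lemma resampleList_sum {K : Type*} (q : ℝ) (l : List E) (s : Finset K)
    (F : K → (E → Bool) → ℝ) :
    resampleList q l (fun x => ∑ k ∈ s, F k x) = fun x => ∑ k ∈ s, resampleList q l (F k) x := by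
  induction l with
  | nil => rfl
  | cons e l ih =>
    rw [resampleList_cons, ih]
    funext x; simp only [resample, resampleList_cons]
    rw [Finset.mul_sum, Finset.mul_sum, ← Finset.sum_add_distrib]

/-- `F` is increasing up to the sign `σ`. -/
def SignMono (σ : ℝ) (F : (E → Bool) → ℝ) : Prop := ∀ x y, x ≤ y → σ * F x ≤ σ * F y

lemma SignMono.resample {σ q : ℝ} (h0 : 0 ≤ q) (h1 : q ≤ 1) (e : E) {F : (E → Bool) → ℝ}
    (h : SignMono σ F) : SignMono σ (resample q e F) := by
  intro x y hxy
  have a := mul_le_mul_of_nonneg_left (h _ _ (update_mono hxy e true)) h0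
  have b := mul_le_mul_of_nonneg_left (h _ _ (update_mono hxy e false)) (sub_nonneg.2 h1)
  simp only [ERGM.resample]
  linarith

lemma SignMono.resampleList {σ q : ℝ} (h0 : 0 ≤ q) (h1 : q ≤ 1) (l : List E)
    {F : (E → Bool) → ℝ} (h : SignMono σ F) : SignMono σ (resampleList q l F) := by
  induction l with
  | nil => exact h
  | cons e l ih => exact ih.resample h0 h1 e

lemma resampleList_mem_Icc {q : ℝ} (h0 : 0 ≤ q) (h1 : q ≤ 1) (l : List E)
    {F : (E → Bool) → ℝ} (hF : ∀ x, F x ∈ Set.Icc (0 : ℝ) 1) (x : E → Bool) :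
    resampleList q l F x ∈ Set.Icc (0 : ℝ) 1 := by
  constructor
  · have := resampleList_mono h0 h1 l (fun x => (hF x).1) x
    rwa [resampleList_const] at this
  · have := resampleList_mono h0 h1 l (fun x => (hF x).2) x
    rwa [resampleList_const] at this

/-- Bounded differences: one resampling step for an exponential. -/
lemma resample_exp_le {q c lam : ℝ} (h0 : 0 ≤ q) (h1 : q ≤ 1) (e : E) {F : (E → Bool) → ℝ}
    (hF : ∀ x, |F (Function.update x e true) - F (Function.update x e false)| ≤ c)
    (hlam : |lam| * c ≤ 1) (x : E → Bool) :
    resample q e (fun x => Real.exp (lam * F x)) x ≤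
      Real.exp (lam * resample q e F x + lam ^ 2 * c ^ 2) := by
  set u := F (Function.update x e true) with hu
  set v := F (Function.update x e false) with hv
  have hd : |u - v| ≤ c := hF x
  have key : ∀ z : ℝ, |z| ≤ |u - v| → Real.exp (lam * z) ≤ 1 + lam * z + lam ^ 2 * c ^ 2 := by
    intro z hz
    have hzc : |z| ≤ c := hz.trans hd
    have h1 : |lam * z| ≤ 1 := by
      rw [abs_mul]
      exact (mul_le_mul_of_nonneg_left hzc (abs_nonneg _)).trans hlam
    have h2 := (abs_le.1 (Real.abs_exp_sub_one_sub_id_le h1)).2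
    have h3 : (lam * z) ^ 2 ≤ lam ^ 2 * c ^ 2 := by
      rw [mul_pow]
      exact mul_le_mul_of_nonneg_left (sq_le_sq' (abs_le.1 hzc).1 (abs_le.1 hzc).2) (sq_nonneg _)
    linarith
  set m := q * u + (1 - q) * v with hm
  have hmu : |u - m| ≤ |u - v| := by
    have : u - m = (1 - q) * (u - v) := by rw [hm]; ring
    rw [this, abs_mul, abs_of_nonneg (sub_nonneg.2 h1)]
    exact mul_le_of_le_one_left (abs_nonneg _) (by linarith)
  have hmv : |v - m| ≤ |u - v| := by
    have : v - m = -(q * (u - v)) := by rw [hm]; ring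
    rw [this, abs_neg, abs_mul, abs_of_nonneg h0]
    exact mul_le_of_le_one_left (abs_nonneg _) (by linarith)
  have e1 : Real.exp (lam * u) = Real.exp (lam * m) * Real.exp (lam * (u - m)) := by
    rw [← Real.exp_add]; ring_nf
  have e2 : Real.exp (lam * v) = Real.exp (lam * m) * Real.exp (lam * (v - m)) := by
    rw [← Real.exp_add]; ring_nf
  have a := mul_le_mul_of_nonneg_left (key _ hmu) h0
  have b := mul_le_mul_of_nonneg_left (key _ hmv) (sub_nonneg.2 h1)
  have hsum : q * Real.exp (lam * (u - m)) + (1 - q) * Real.exp (lam * (v - m))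
      ≤ 1 + lam ^ 2 * c ^ 2 := by
    have : lam * (q * (u - m) + (1 - q) * (v - m)) = 0 := by rw [hm]; ring
    linarith
  show q * Real.exp (lam * u) + (1 - q) * Real.exp (lam * v) ≤ Real.exp (lam * m + _)
  rw [Real.exp_add, e1, e2]
  have h4 : 1 + lam ^ 2 * c ^ 2 ≤ Real.exp (lam ^ 2 * c ^ 2) := by
    linarith [Real.add_one_le_exp (lam ^ 2 * c ^ 2)]
  calc _ = Real.exp (lam * m) *
        (q * Real.exp (lam * (u - m)) + (1 - q) * Real.exp (lam * (v - m))) := by ring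
    _ ≤ _ := mul_le_mul_of_nonneg_left (hsum.trans h4) (Real.exp_pos _).le

/-- Resampling does not increase the influence of a coordinate. -/
lemma resample_influence {q : ℝ} (h0 : 0 ≤ q) (h1 : q ≤ 1) (e f : E) {c : ℝ} (hc : 0 ≤ c)
    {F : (E → Bool) → ℝ}
    (hF : ∀ x, |F (Function.update x f true) - F (Function.update x f false)| ≤ c)
    (x : E → Bool) :
    |resample q e F (Function.update x f true) - resample q e F (Function.update x f false)|
      ≤ c := by
  by_cases hef : f = e
  · subst hef
    simpa [resample] using hc
  · have comm : ∀ b b', Function.update (Function.update x f b) e b' =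
        Function.update (Function.update x e b') f b := fun b b' =>
      Function.update_comm hef b b' x
    simp only [resample, comm]
    have a := hF (Function.update x e true)
    have b := hF (Function.update x e false)
    have e1 : ∀ A B C D : ℝ, q * A + (1 - q) * B - (q * C + (1 - q) * D) =
        q * (A - C) + (1 - q) * (B - D) := by intros; ring
    rw [e1]
    refine (abs_add_le _ _).trans ?_
    rw [abs_mul, abs_mul, abs_of_nonneg h0, abs_of_nonneg (sub_nonneg.2 h1)]
    have a' := mul_le_mul_of_nonneg_left a h0
    have b' := mul_le_mul_of_nonneg_left b (sub_nonneg.2 h1)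
    linarith

lemma resampleList_influence {q : ℝ} (h0 : 0 ≤ q) (h1 : q ≤ 1) (l : List E) (f : E) {c : ℝ}
    (hc : 0 ≤ c) {F : (E → Bool) → ℝ}
    (hF : ∀ x, |F (Function.update x f true) - F (Function.update x f false)| ≤ c)
    (x : E → Bool) :
    |resampleList q l F (Function.update x f true) -
      resampleList q l F (Function.update x f false)| ≤ c := by
  induction l generalizing x with
  | nil => exact hF x
  | cons e l ih => exact resample_influence h0 h1 e f hc ih x

/-- Bounded differences inequality (exponential moment form) under product Bernoulli
resampling. -/
lemma resampleList_exp_le {q lam : ℝ} (h0 : 0 ≤ q) (h1 : q ≤ 1) (c : E → ℝ)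
    (hc : ∀ e, 0 ≤ c e) {F : (E → Bool) → ℝ}
    (hF : ∀ e x, |F (Function.update x e true) - F (Function.update x e false)| ≤ c e)
    (hlam : ∀ e, |lam| * c e ≤ 1) (l : List E) (x : E → Bool) :
    resampleList q l (fun x => Real.exp (lam * F x)) x ≤
      Real.exp (lam * resampleList q l F x + lam ^ 2 * (l.map fun e => c e ^ 2).sum) := by
  induction l generalizing x with
  | nil => simp
  | cons e l ih =>
    rw [resampleList_cons, resampleList_cons]
    refine (resample_mono h0 h1 e ih x).trans ?_
    set S := (l.map fun e => c e ^ 2).sum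
    have := resample_exp_le h0 h1 e
      (fun x => resampleList_influence h0 h1 l e (hc e) (hF e) x) (hlam e) x
    have e1 : resample q e (fun x => Real.exp (lam * resampleList q l F x + lam ^ 2 * S)) x =
        Real.exp (lam ^ 2 * S) *
          resample q e (fun x => Real.exp (lam * resampleList q l F x)) x := by
      simp only [resample, Real.exp_add]; ring
    rw [e1, List.map_cons, List.sum_cons]
    refine (mul_le_mul_of_nonneg_left this (Real.exp_pos _).le).trans (le_of_eq ?_)
    rw [← Real.exp_add]
    congr 1
    ring

lemma mon_of_mem {T : Finset E} {e : E} (he : e ∈ T) (x : E → Bool) :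
    mon T x = ind (x e) * mon (T.erase e) x := (Finset.mul_prod_erase T _ he).symm

lemma mon_update_of_notMem {T : Finset E} {e : E} (he : e ∉ T) (x : E → Bool) (b : Bool) :
    mon T (Function.update x e b) = mon T x := by
  refine Finset.prod_congr rfl fun f hf => ?_
  rw [Function.update_of_ne (ne_of_mem_of_not_mem hf he)]

lemma mon_update_of_mem {T : Finset E} {e : E} (he : e ∈ T) (x : E → Bool) (b : Bool) :
    mon T (Function.update x e b) = ind b * mon (T.erase e) x := by
  rw [mon_of_mem he, mon_update_of_notMem (Finset.notMem_erase e T), Function.update_self]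

/-- Increments of a monomial are controlled by its discrete derivatives at the top point. -/
lemma mon_sub_le (T : Finset E) {x y : E → Bool} (h : x ≤ y) :
    mon T y - mon T x ≤ ∑ f ∈ T, (ind (y f) - ind (x f)) * mon (T.erase f) y := by
  have hnn : ∀ f ∈ T, 0 ≤ (ind (y f) - ind (x f)) * mon (T.erase f) y := fun f _ =>
    mul_nonneg (sub_nonneg.2 (ind_mono (h f))) (mon_nonneg _ _)
  by_cases hy : ∀ f ∈ T, y f = true
  · by_cases hx : ∀ f ∈ T, x f = true
    · have h1 : mon T y = mon T x :=
        Finset.prod_congr rfl fun f hf => by simp [hx f hf, hy f hf]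
      rw [h1, sub_self]
      exact Finset.sum_nonneg hnn
    · push Not at hx
      obtain ⟨f, hf, hxf⟩ := hx
      refine le_trans ?_ (Finset.single_le_sum hnn hf)
      have h1 : mon (T.erase f) y = 1 :=
        Finset.prod_eq_one fun g hg => by rw [hy g (Finset.mem_of_mem_erase hg), ind_true]
      have h2 : x f = false := by simpa using hxf
      rw [h1, hy f hf, h2, ind_true, ind_false]
      linarith [mon_le_one T y, mon_nonneg T x]
  · have : mon T y = 0 := by rw [mon_eq_ite, if_neg hy]
    linarith [mon_nonneg T x, Finset.sum_nonneg hnn]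

lemma resample_mon (q : ℝ) (e : E) (T : Finset E) :
    resample q e (mon T) = fun x => (if e ∈ T then q else 1) * mon (T.erase e) x := by
  funext x
  unfold resample
  by_cases he : e ∈ T
  · rw [mon_update_of_mem he, mon_update_of_mem he, ind_true, ind_false, if_pos he]; ring
  · rw [mon_update_of_notMem he, mon_update_of_notMem he, if_neg he, Finset.erase_eq_of_notMem he]
    ring

lemma resampleList_mon (q : ℝ) (l : List E) (hl : l.Nodup) (T : Finset E) :
    resampleList q l (mon T) = fun x => q ^ #(T ∩ l.toFinset) * mon (T \ l.toFinset) x := by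
  induction l with
  | nil => simp
  | cons e l ih =>
    rw [List.nodup_cons] at hl
    rw [resampleList_cons, ih hl.2]
    have he : e ∉ l.toFinset := by simpa using hl.1
    have e0 : resample q e (fun x => q ^ #(T ∩ l.toFinset) * mon (T \ l.toFinset) x) =
        fun x => q ^ #(T ∩ l.toFinset) * resample q e (mon (T \ l.toFinset)) x := by
      funext x; simp only [resample]; ring
    rw [e0, resample_mon, List.toFinset_cons]
    funext x
    have e1 : (T \ l.toFinset).erase e = T \ insert e l.toFinset := by
      ext f; simp; tauto
    rw [e1, ← mul_assoc]
    congr 1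
    by_cases heT : e ∈ T
    · have e2 : T ∩ insert e l.toFinset = insert e (T ∩ l.toFinset) := by
        ext f; simp only [Finset.mem_inter, Finset.mem_insert]
        constructor
        · tauto
        · rintro (rfl | h) <;> tauto
      rw [e2, Finset.card_insert_of_notMem (by simp [hl.1]), if_pos (by simp [heT, hl.1]), pow_succ]
    · have e2 : T ∩ insert e l.toFinset = T ∩ l.toFinset := by
        ext f; simp only [Finset.mem_inter, Finset.mem_insert]
        constructor
        · rintro ⟨h1, rfl | h2⟩ <;> tauto
        · tauto
      rw [e2, if_neg (by simp [heT]), mul_one]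

/-- Expectation of a monomial when every coordinate is resampled. -/
lemma resampleList_univ_mon [Fintype E] (q : ℝ) (T : Finset E) :
    resampleList q (Finset.univ : Finset E).toList (mon T) = fun _ => q ^ #T := by
  rw [resampleList_mon q _ (Finset.nodup_toList _)]
  funext x
  simp [mon, Finset.sdiff_eq_empty_iff_subset.2 (Finset.subset_univ T)]

end Operators

section Averages

variable {Ω : Type*} [Fintype Ω]

/-- Average of `F` with respect to an unnormalised weight. -/
noncomputable def avg (w F : Ω → ℝ) : ℝ := (∑ x, w x * F x) / ∑ x, w x

lemma avg_mono {w F G : Ω → ℝ} (hw : ∀ x, 0 < w x) (h : ∀ x, F x ≤ G x) : avg w F ≤ avg w G := by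
  unfold avg
  have : 0 ≤ ∑ x, w x := Finset.sum_nonneg fun x _ => (hw x).le
  gcongr with x
  · exact (hw x).le
  · exact h x

lemma avg_const [Nonempty Ω] {w : Ω → ℝ} (hw : ∀ x, 0 < w x) (c : ℝ) :
    avg w (fun _ => c) = c := by
  unfold avg
  have : 0 < ∑ x, w x := Finset.sum_pos (fun x _ => hw x) Finset.univ_nonempty
  rw [← Finset.sum_mul, mul_div_assoc, mul_div_cancel₀]
  exact this.ne'

lemma avg_add (w F G : Ω → ℝ) : avg w (fun x => F x + G x) = avg w F + avg w G := by
  simp only [avg, mul_add, Finset.sum_add_distrib, add_div]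

lemma avg_sub (w F G : Ω → ℝ) : avg w (fun x => F x - G x) = avg w F - avg w G := by
  simp only [avg, mul_sub, Finset.sum_sub_distrib, sub_div]

lemma avg_const_mul (w F : Ω → ℝ) (c : ℝ) : avg w (fun x => c * F x) = c * avg w F := by
  simp only [avg, mul_left_comm _ c, ← Finset.mul_sum, mul_div_assoc]

lemma avg_sum {K : Type*} (w : Ω → ℝ) (s : Finset K) (F : K → Ω → ℝ) :
    avg w (fun x => ∑ k ∈ s, F k x) = ∑ k ∈ s, avg w (F k) := by
  simp only [avg, Finset.mul_sum]
  rw [Finset.sum_comm, Finset.sum_div]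

lemma avg_nonneg {w F : Ω → ℝ} (hw : ∀ x, 0 < w x) (h : ∀ x, 0 ≤ F x) : 0 ≤ avg w F :=
  div_nonneg (Finset.sum_nonneg fun x _ => mul_nonneg (hw x).le (h x))
    (Finset.sum_nonneg fun x _ => (hw x).le)

lemma abs_avg_le {w F : Ω → ℝ} (hw : ∀ x, 0 < w x) : |avg w F| ≤ avg w (fun x => |F x|) := by
  rw [abs_le]
  constructor
  · have := avg_mono (F := fun x => (-1) * |F x|) (G := F) hw
      fun x => by linarith [neg_abs_le (F x)]
    rw [avg_const_mul] at this
    linarith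
  · exact avg_mono hw fun x => le_abs_self _

/-- Jensen's inequality for the exponential, against a tilted weight. -/
lemma avg_exp_le_exp_avg_tilt [Nonempty Ω] {w S : Ω → ℝ} (hw : ∀ x, 0 < w x) :
    avg w (fun x => Real.exp (S x)) ≤
      Real.exp (avg (fun x => w x * Real.exp (S x)) S) := by
  set w' := fun x => w x * Real.exp (S x) with hw'
  have hw'0 : ∀ x, 0 < w' x := fun x => mul_pos (hw x) (Real.exp_pos _)
  have Z : 0 < ∑ x, w x := Finset.sum_pos (fun x _ => hw x) Finset.univ_nonempty
  have Z' : 0 < ∑ x, w' x := Finset.sum_pos (fun x _ => hw'0 x) Finset.univ_nonempty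
  set m := avg w' S
  have h1 : avg w' (fun x => Real.exp (-m) * (1 + m - S x)) ≤
      avg w' (fun x => Real.exp (-S x)) := by
    refine avg_mono hw'0 fun x => ?_
    have : Real.exp (-S x) = Real.exp (-m) * Real.exp (m - S x) := by
      rw [← Real.exp_add]; ring_nf
    rw [this]
    have := Real.add_one_le_exp (m - S x)
    exact mul_le_mul_of_nonneg_left (by linarith) (Real.exp_pos _).le
  rw [avg_const_mul, avg_sub, avg_const hw'0, add_sub_cancel_right, mul_one] at h1
  have h2 : avg w' (fun x => Real.exp (-S x)) = (∑ x, w x) / ∑ x, w' x := by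
    unfold avg
    congr 1
    refine Finset.sum_congr rfl fun x _ => ?_
    rw [hw', mul_assoc, ← Real.exp_add, add_neg_cancel, Real.exp_zero, mul_one]
  have h3 : avg w (fun x => Real.exp (S x)) = (∑ x, w' x) / ∑ x, w x := rfl
  rw [h2, le_div_iff₀ Z'] at h1
  rw [h3, div_le_iff₀ Z]
  have := mul_le_mul_of_nonneg_left h1 (Real.exp_pos m).le
  rwa [← mul_assoc, ← Real.exp_add, add_neg_cancel, Real.exp_zero, one_mul] at this

end Averages

lemma Phi_pos (u : ℝ) : 0 < Phi u := by unfold Phi; positivity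

lemma Phi_lt_one (u : ℝ) : Phi u < 1 := by
  unfold Phi
  rw [div_lt_one (by positivity)]
  linarith [Real.exp_pos u]

lemma hasDerivAt_Phi (u : ℝ) : HasDerivAt Phi (Phi u * (1 - Phi u)) u := by
  have h0 : 1 + Real.exp u ≠ 0 := by positivity
  have := (Real.hasDerivAt_exp u).div ((Real.hasDerivAt_exp u).const_add 1) h0
  refine this.congr_deriv ?_
  unfold Phi
  field_simp

lemma continuous_Phi : Continuous Phi :=
  continuous_iff_continuousAt.2 fun u => (hasDerivAt_Phi u).continuousAt

lemma Phi_sub_le {Λ u v : ℝ} (huv : u ≤ v)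
    (h : ∀ z ∈ Set.Icc u v, Phi z * (1 - Phi z) ≤ Λ) : Phi v - Phi u ≤ Λ * (v - u) := by
  refine (convex_Icc u v).image_sub_le_mul_sub_of_deriv_le continuous_Phi.continuousOn
    (fun z _ => (hasDerivAt_Phi z).differentiableAt.differentiableWithinAt) (fun z hz => ?_)
    u (Set.left_mem_Icc.2 huv) v (Set.right_mem_Icc.2 huv) huv
  rw [(hasDerivAt_Phi z).deriv]
  exact h z (interior_subset hz)

lemma Phi_deriv_le_one (z : ℝ) : Phi z * (1 - Phi z) ≤ 1 := by
  nlinarith [Phi_pos z, Phi_lt_one z]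

lemma Phi_mono : Monotone Phi :=
  monotone_of_deriv_nonneg (fun u => (hasDerivAt_Phi u).differentiableAt) fun u => by
    rw [(hasDerivAt_Phi u).deriv]
    exact mul_nonneg (Phi_pos u).le (sub_nonneg.2 (Phi_lt_one u).le)

lemma abs_Phi_sub_le (u v : ℝ) : |Phi v - Phi u| ≤ |v - u| := by
  rcases le_total u v with h | h
  · rw [abs_of_nonneg (sub_nonneg.2 (Phi_mono h)), abs_of_nonneg (sub_nonneg.2 h)]
    simpa using Phi_sub_le h fun z _ => Phi_deriv_le_one z
  · rw [abs_sub_comm, abs_sub_comm v, abs_of_nonneg (sub_nonneg.2 (Phi_mono h)),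
      abs_of_nonneg (sub_nonneg.2 h)]
    simpa using Phi_sub_le h fun z _ => Phi_deriv_le_one z

/-- A ferromagnetic polynomial energy: nonnegative combination of monomials. -/
structure Energy (E I : Type*) where
  /-- coefficients of the monomials -/
  coeff : I → ℝ
  /-- supports of the monomials -/
  supp : I → Finset E
  coeff_nonneg : ∀ k, 0 ≤ coeff k

namespace Energy

section Basic

variable {E I : Type*} [Fintype I] (D : Energy E I)

/-- The value of the energy. -/
noncomputable def ham (x : E → Bool) : ℝ := ∑ k, D.coeff k * mon (D.supp k) x

lemma ham_supermodular (x y : E → Bool) :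
    D.ham x + D.ham y ≤ D.ham (x ⊓ y) + D.ham (x ⊔ y) := by
  simp only [ham, ← Finset.sum_add_distrib, ← mul_add]
  exact Finset.sum_le_sum fun k _ =>
    mul_le_mul_of_nonneg_left (mon_supermodular _ x y) (D.coeff_nonneg k)

variable [Fintype E]

/-- The Gibbs weight with external field `h`. -/
noncomputable def weight (h : E → ℝ) (x : E → Bool) : ℝ :=
  Real.exp (D.ham x + ∑ e, h e * ind (x e))

lemma weight_pos (h : E → ℝ) (x : E → Bool) : 0 < D.weight h x := Real.exp_pos _

lemma weight_logSupermodular (h : E → ℝ) (x y : E → Bool) :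
    D.weight h x * D.weight h y ≤ D.weight h (x ⊓ y) * D.weight h (x ⊔ y) := by
  simp only [weight, ← Real.exp_add]
  refine Real.exp_le_exp.2 ?_
  have h1 := D.ham_supermodular x y
  have h2 : ∑ e, h e * ind (x e) + ∑ e, h e * ind (y e) =
      ∑ e, h e * ind ((x ⊓ y) e) + ∑ e, h e * ind ((x ⊔ y) e) := by
    simp only [← Finset.sum_add_distrib, ← mul_add]
    refine Finset.sum_congr rfl fun e _ => ?_
    congr 1
    simp only [Pi.inf_apply, Pi.sup_apply]
    cases x e <;> cases y e <;> simp [ind]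
  linarith

lemma weight_add (h g : E → ℝ) (x : E → Bool) :
    D.weight (fun e => h e + g e) x = D.weight h x * Real.exp (∑ e, g e * ind (x e)) := by
  simp only [weight, ← Real.exp_add, add_mul, Finset.sum_add_distrib, add_assoc]

variable [DecidableEq E]

/-- Monotonicity of the Gibbs averages in the external field (via FKG). -/
lemma avg_weight_mono {h h' : E → ℝ} (hh : ∀ e, h e ≤ h' e) {F : (E → Bool) → ℝ}
    (hF0 : ∀ x, 0 ≤ F x) (hF : Monotone F) :
    avg (D.weight h) F ≤ avg (D.weight h') F := by
  set g : (E → Bool) → ℝ := fun x => Real.exp (∑ e, (h' e - h e) * ind (x e)) with hg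
  have hgm : Monotone g := fun x y hxy => Real.exp_le_exp.2 <| Finset.sum_le_sum fun e _ =>
    mul_le_mul_of_nonneg_left (ind_mono (hxy e)) (sub_nonneg.2 (hh e))
  have key := fkg (μ := D.weight h) (f := F) (g := g) (fun x => (D.weight_pos h x).le) hF0
    (fun x => (Real.exp_pos _).le) hF hgm (D.weight_logSupermodular h)
  have e1 : ∀ x, D.weight h' x = D.weight h x * g x := fun x => by
    rw [hg, ← weight_add]
    congr 1
    funext e; ring
  have Z : 0 < ∑ x, D.weight h x :=
    Finset.sum_pos (fun x _ => D.weight_pos h x) Finset.univ_nonempty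
  have Z' : 0 < ∑ x, D.weight h x * g x :=
    Finset.sum_pos (fun x _ => mul_pos (D.weight_pos h x) (Real.exp_pos _)) Finset.univ_nonempty
  unfold avg
  simp only [e1]
  rw [div_le_div_iff₀ Z Z']
  refine key.trans (le_of_eq ?_)
  rw [mul_comm]
  congr 1
  exact Finset.sum_congr rfl fun x _ => by ring

end Basic

section Slope

variable {E I : Type*} [Fintype I] [DecidableEq E] (D : Energy E I)

/-- The discrete derivative of the energy at the coordinate `e`. -/
noncomputable def slope (e : E) (x : E → Bool) : ℝ :=
  ∑ k, if e ∈ D.supp k then D.coeff k * mon ((D.supp k).erase e) x else 0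

/-- The sum over `e` of the mixed second discrete derivatives of the energy at `f` and `e`. -/
noncomputable def row (f : E) (x : E → Bool) : ℝ :=
  ∑ k, if f ∈ D.supp k then
    D.coeff k * ∑ e ∈ (D.supp k).erase f, mon (((D.supp k).erase f).erase e) x else 0

lemma slope_mono (e : E) : Monotone (D.slope e) := fun x y hxy =>
  Finset.sum_le_sum fun k _ => by
    split_ifs
    · exact mul_le_mul_of_nonneg_left (mon_mono _ hxy) (D.coeff_nonneg k)
    · exact le_rfl

lemma row_mono (e : E) : Monotone (D.row e) := fun x y hxy =>
  Finset.sum_le_sum fun k _ => by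
    split_ifs
    · exact mul_le_mul_of_nonneg_left (Finset.sum_le_sum fun _ _ => mon_mono _ hxy)
        (D.coeff_nonneg k)
    · exact le_rfl

lemma slope_nonneg (e : E) (x : E → Bool) : 0 ≤ D.slope e x :=
  Finset.sum_nonneg fun k _ => by
    split_ifs
    · exact mul_nonneg (D.coeff_nonneg k) (mon_nonneg _ _)
    · exact le_rfl

lemma slope_update_self (e : E) (x : E → Bool) (b : Bool) :
    D.slope e (Function.update x e b) = D.slope e x :=
  Finset.sum_congr rfl fun k _ => by rw [mon_update_of_notMem (Finset.notMem_erase _ _)]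

lemma ham_update_sub (e : E) (x : E → Bool) :
    D.ham (Function.update x e true) - D.ham (Function.update x e false) = D.slope e x := by
  simp only [ham, slope, ← Finset.sum_sub_distrib, ← mul_sub]
  refine Finset.sum_congr rfl fun k _ => ?_
  split_ifs with hk
  · rw [mon_update_of_mem hk, mon_update_of_mem hk, ind_true, ind_false]; ring
  · rw [mon_update_of_notMem hk, mon_update_of_notMem hk]; ring

variable [Fintype E]

lemma sum_eq_sum_update (e : E) (F : (E → Bool) → ℝ) :
    ∑ x, F x = ∑ x, (F (Function.update x e true) + F (Function.update x e false)) / 2 := by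
  have inv : Function.Involutive fun x : E → Bool => Function.update x e (!x e) := fun x => by
    simp
  have h1 : ∑ x, F (Function.update x e (!x e)) = ∑ x, F x :=
    Equiv.sum_comp inv.toPerm F
  have h2 : ∀ x, F (Function.update x e true) + F (Function.update x e false) =
      F x + F (Function.update x e (!x e)) := fun x => by
    have hx := Function.update_eq_self e x
    cases hxe : x e
    · rw [hxe] at hx
      rw [hx, Bool.not_false, add_comm]
    · rw [hxe] at hx
      rw [hx, Bool.not_true]
  simp only [h2, ← Finset.sum_div, Finset.sum_add_distrib, h1]
  ring

/-- The conditional probability that `x e = true` given the other coordinates. -/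
noncomputable def rate (h : E → ℝ) (e : E) (x : E → Bool) : ℝ := Phi (D.slope e x + h e)

/-- The Gibbs resampling (DLR) identity. -/
lemma avg_gibbs (h : E → ℝ) (e : E) (F : (E → Bool) → ℝ) :
    avg (D.weight h) F = avg (D.weight h) fun x => D.rate h e x * F (Function.update x e true) +
      (1 - D.rate h e x) * F (Function.update x e false) := by
  unfold avg
  congr 1
  rw [sum_eq_sum_update e, sum_eq_sum_update e (fun x => D.weight h x * _)]
  refine Finset.sum_congr rfl fun x _ => ?_
  have hr : ∀ b, D.rate h e (Function.update x e b) = D.rate h e x := fun b => by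
    rw [rate, slope_update_self, rate]
  have hlin : ∑ f, h f * ind (Function.update x e true f) =
      ∑ f, h f * ind (Function.update x e false f) + h e := by
    rw [← Finset.add_sum_erase _ _ (Finset.mem_univ e),
      ← Finset.add_sum_erase (a := e) _ (fun f => h f * ind (Function.update x e false f))
        (Finset.mem_univ e)]
    rw [Function.update_self, Function.update_self, ind_true, ind_false]
    have : ∑ f ∈ Finset.univ.erase e, h f * ind (Function.update x e true f) =
        ∑ f ∈ Finset.univ.erase e, h f * ind (Function.update x e false f) :=
      Finset.sum_congr rfl fun f hf => by
        rw [Function.update_of_ne (Finset.ne_of_mem_erase hf),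
          Function.update_of_ne (Finset.ne_of_mem_erase hf)]
    rw [this]; ring
  have hw : D.weight h (Function.update x e true) =
      D.weight h (Function.update x e false) * Real.exp (D.slope e x + h e) := by
    simp only [weight]
    rw [← Real.exp_add, hlin, ← ham_update_sub]
    congr 1; ring
  simp only [Function.update_idem, hr, hw]
  have hpos : 1 + Real.exp (D.slope e x + h e) ≠ 0 := by positivity
  simp only [rate, Phi]
  field_simp
  ring

/-- Comparison of a Gibbs average with a product average. -/
lemma avg_le_resampleList (h : E → ℝ) {σ q δ : ℝ} (hσ : σ ^ 2 = 1) (h0 : 0 ≤ q) (h1 : q ≤ 1)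
    {B : (E → Bool) → ℝ} (hB0 : ∀ x, 0 ≤ B x)
    (hB : ∀ e x, 0 < σ * (D.rate h e x - q) → 1 ≤ B x) (hδ : avg (D.weight h) B ≤ δ)
    (l : List E) {F : (E → Bool) → ℝ} (hF : SignMono σ F) (hF01 : ∀ x, F x ∈ Set.Icc (0 : ℝ) 1) :
    avg (D.weight h) F ≤ avg (D.weight h) (resampleList q l F) + l.length * δ := by
  induction l with
  | nil => simp
  | cons e l ih =>
    refine ih.trans ?_
    set G := resampleList q l F
    have hG : SignMono σ G := hF.resampleList h0 h1 l
    have hG01 : ∀ x, G x ∈ Set.Icc (0 : ℝ) 1 := resampleList_mem_Icc h0 h1 l hF01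
    have key : avg (D.weight h) G ≤ avg (D.weight h) (fun x => resample q e G x + B x) := by
      rw [D.avg_gibbs h e G]
      refine avg_mono (D.weight_pos h) fun x => ?_
      set r := D.rate h e x with hr
      set u := G (Function.update x e true) with hu
      set v := G (Function.update x e false) with hv
      have hr0 : 0 < r := Phi_pos _
      have hr1 : r < 1 := Phi_lt_one _
      have hmono : σ * v ≤ σ * u := hG _ _ (update_false_le_true x e)
      have hu01 := hG01 (Function.update x e true)
      have hv01 := hG01 (Function.update x e false)
      show r * u + (1 - r) * v ≤ q * u + (1 - q) * v + B x
      by_cases hc : 0 < σ * (r - q)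
      · have hBx := hB e x hc
        have a1 : r * u + (1 - r) * v ≤ 1 := by nlinarith [hu01.2, hv01.2]
        have a2 : 0 ≤ q * u + (1 - q) * v :=
          add_nonneg (mul_nonneg h0 hu01.1) (mul_nonneg (sub_nonneg.2 h1) hv01.1)
        linarith
      · have e1 : r * u + (1 - r) * v - (q * u + (1 - q) * v) =
            σ ^ 2 * ((r - q) * (u - v)) := by rw [hσ]; ring
        have e2 : σ ^ 2 * ((r - q) * (u - v)) = (σ * (r - q)) * (σ * u - σ * v) := by ring
        have a3 : (σ * (r - q)) * (σ * u - σ * v) ≤ 0 :=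
          mul_nonpos_of_nonpos_of_nonneg (not_lt.1 hc) (sub_nonneg.2 hmono)
        linarith [hB0 x]
    rw [avg_add] at key
    rw [resampleList_cons, List.length_cons]
    push_cast
    linarith

end Slope

end Energy

namespace Energy

section Exceed

variable {E : Type*}

open scoped Classical in
/-- Indicator that some `F e` lies strictly beyond the level `a` in the direction `σ`. -/
noncomputable def exceed (σ a : ℝ) (F : E → (E → Bool) → ℝ) (x : E → Bool) : ℝ :=
  if ∃ e, 0 < σ * (F e x - a) then 1 else 0

lemma exceed_mem_Icc (σ a : ℝ) (F : E → (E → Bool) → ℝ) (x : E → Bool) :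
    exceed σ a F x ∈ Set.Icc (0 : ℝ) 1 := by
  unfold exceed
  split_ifs <;> simp

lemma exceed_signMono {σ : ℝ} (hσ : σ = 1 ∨ σ = -1) (a : ℝ) {F : E → (E → Bool) → ℝ}
    (hF : ∀ e, Monotone (F e)) : SignMono σ (exceed σ a F) := by
  intro x y hxy
  unfold exceed
  rcases hσ with rfl | rfl
  · by_cases hx : ∃ e, 0 < (1 : ℝ) * (F e x - a)
    · obtain ⟨e, he⟩ := hx
      rw [if_pos ⟨e, he⟩, if_pos ⟨e, by linarith [hF e hxy]⟩]
    · rw [if_neg hx]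
      split_ifs <;> norm_num
  · by_cases hy : ∃ e, 0 < (-1 : ℝ) * (F e y - a)
    · obtain ⟨e, he⟩ := hy
      rw [if_pos ⟨e, by linarith [hF e hxy]⟩, if_pos ⟨e, he⟩]
    · rw [if_neg hy]
      split_ifs <;> norm_num

end Exceed

section Tail

variable {E I : Type*} [Fintype I] [DecidableEq E] (D : Energy E I)

/-- Total coefficient of the monomials involving `e`. -/
noncomputable def degree (e : E) : ℝ := ∑ k, if e ∈ D.supp k then D.coeff k else 0

/-- Total coefficient of the monomials involving both `e` and `f`. -/
noncomputable def codegree (e f : E) : ℝ :=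
  ∑ k, if e ∈ D.supp k ∧ f ∈ D.supp k then D.coeff k else 0

lemma codegree_nonneg (e f : E) : 0 ≤ D.codegree e f :=
  Finset.sum_nonneg fun k _ => by
    split_ifs
    · exact D.coeff_nonneg k
    · exact le_rfl

/-- Bounds on the degrees and codegrees of an energy. -/
structure Sparse (d : ℕ) (K ν : ℝ) : Prop where
  card_le : ∀ k, #(D.supp k) ≤ d
  degree_le : ∀ e, D.degree e ≤ K
  codegree_le : ∀ e f, e ≠ f → D.codegree e f ≤ K / ν

/-- The influence of `f` on the slope at `e`. -/
noncomputable def influence (e f : E) : ℝ := if f = e then 0 else D.codegree e f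

lemma influence_nonneg (e f : E) : 0 ≤ D.influence e f := by
  unfold influence
  split_ifs
  · exact le_rfl
  · exact D.codegree_nonneg e f

lemma abs_mon_update_sub_le (T : Finset E) (f : E) (x : E → Bool) :
    |mon T (Function.update x f true) - mon T (Function.update x f false)| ≤
      if f ∈ T then 1 else 0 := by
  split_ifs with hf
  · rw [mon_update_of_mem hf, mon_update_of_mem hf, ind_true, ind_false, one_mul, zero_mul,
      sub_zero, abs_of_nonneg (mon_nonneg _ _)]
    exact mon_le_one _ _
  · rw [mon_update_of_notMem hf, mon_update_of_notMem hf, sub_self, abs_zero]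

lemma slope_influence (e f : E) (x : E → Bool) :
    |D.slope e (Function.update x f true) - D.slope e (Function.update x f false)| ≤
      D.influence e f := by
  unfold influence
  split_ifs with hfe
  · subst hfe
    rw [slope_update_self, slope_update_self, sub_self, abs_zero]
  · simp only [slope, codegree, ← Finset.sum_sub_distrib]
    refine (Finset.abs_sum_le_sum_abs _ _).trans (Finset.sum_le_sum fun k _ => ?_)
    by_cases he : e ∈ D.supp k
    · have := abs_mon_update_sub_le ((D.supp k).erase e) f x
      rw [if_pos he, if_pos he, ← mul_sub, abs_mul, abs_of_nonneg (D.coeff_nonneg k)]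
      refine (mul_le_mul_of_nonneg_left this (D.coeff_nonneg k)).trans (le_of_eq ?_)
      simp [he, hfe]
    · simp [he]

lemma row_influence {d : ℕ} (hd : ∀ k, #(D.supp k) ≤ d) (e f : E) (x : E → Bool) :
    |D.row e (Function.update x f true) - D.row e (Function.update x f false)| ≤
      d * D.influence e f := by
  unfold influence
  split_ifs with hfe
  · subst hfe
    have : ∀ b, D.row f (Function.update x f b) = D.row f x := fun b =>
      Finset.sum_congr rfl fun k _ => by
        congr 2
        exact Finset.sum_congr rfl fun g _ => mon_update_of_notMem (by simp) _ _
    rw [this, this, sub_self, abs_zero, mul_zero]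
  · simp only [row, codegree, ← Finset.sum_sub_distrib, Finset.mul_sum]
    refine (Finset.abs_sum_le_sum_abs _ _).trans (Finset.sum_le_sum fun k _ => ?_)
    by_cases he : e ∈ D.supp k
    · rw [if_pos he, if_pos he, ← Finset.sum_sub_distrib]
      refine (Finset.abs_sum_le_sum_abs _ _).trans ?_
      have hb : ∀ g ∈ (D.supp k).erase e,
          |D.coeff k * mon (((D.supp k).erase e).erase g) (Function.update x f true) -
            D.coeff k * mon (((D.supp k).erase e).erase g) (Function.update x f false)| ≤
          if e ∈ D.supp k ∧ f ∈ D.supp k then D.coeff k else 0 := by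
        intro g _
        have := abs_mon_update_sub_le (((D.supp k).erase e).erase g) f x
        rw [← mul_sub, abs_mul, abs_of_nonneg (D.coeff_nonneg k)]
        refine (mul_le_mul_of_nonneg_left this (D.coeff_nonneg k)).trans ?_
        by_cases hf : f ∈ D.supp k
        · rw [if_pos (⟨he, hf⟩ : e ∈ D.supp k ∧ f ∈ D.supp k)]
          refine mul_le_of_le_one_right (D.coeff_nonneg k) ?_
          split_ifs <;> norm_num
        · rw [if_neg (by simp [hf]), if_neg (by simp [hf]), mul_zero]
      refine (Finset.sum_le_sum hb).trans ?_
      rw [Finset.sum_const, nsmul_eq_mul]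
      refine mul_le_mul_of_nonneg_right ?_ ?_
      · exact_mod_cast (Finset.card_erase_le).trans (hd k)
      · split_ifs
        · exact D.coeff_nonneg k
        · exact le_rfl
    · simp [he]

lemma Sparse.influence_le {D : Energy E I} {d : ℕ} {K ν : ℝ} (hD : D.Sparse d K ν) (hν : 0 < ν)
    (hK : 0 ≤ K) (e f : E) : D.influence e f ≤ K / ν := by
  unfold influence
  split_ifs with h
  · positivity
  · exact hD.codegree_le e f (Ne.symm h)

variable [Fintype E]

lemma sum_codegree_le {d : ℕ} (hd : ∀ k, #(D.supp k) ≤ d) (e : E) :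
    ∑ f, D.codegree e f ≤ d * D.degree e := by
  simp only [codegree, degree]
  rw [Finset.sum_comm, Finset.mul_sum]
  refine Finset.sum_le_sum fun k _ => ?_
  by_cases he : e ∈ D.supp k
  · simp only [he, true_and, if_true]
    rw [← Finset.sum_filter, Finset.sum_const, nsmul_eq_mul]
    refine mul_le_mul_of_nonneg_right ?_ (D.coeff_nonneg k)
    rw [Finset.filter_mem_eq_inter, Finset.univ_inter]
    exact_mod_cast hd k
  · simp [he]

lemma Sparse.sum_influence_sq_le {D : Energy E I} {d : ℕ} {K ν : ℝ} (hD : D.Sparse d K ν)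
    (hν : 0 < ν) (hK : 0 ≤ K) (e : E) :
    ∑ f, D.influence e f ^ 2 ≤ d * K ^ 2 / ν := by
  have h1 : ∀ f, D.influence e f ^ 2 ≤ K / ν * D.codegree e f := fun f => by
    have a := D.influence_nonneg e f
    have b : D.influence e f ≤ D.codegree e f := by
      unfold influence
      split_ifs
      · exact D.codegree_nonneg e f
      · exact le_rfl
    rw [sq]
    exact mul_le_mul (hD.influence_le hν hK e f) b a (by positivity)
  refine (Finset.sum_le_sum fun f _ => h1 f).trans ?_
  rw [← Finset.mul_sum]
  have h2 : ∑ f, D.codegree e f ≤ d * K :=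
    (D.sum_codegree_le hD.card_le e).trans
      (mul_le_mul_of_nonneg_left (hD.degree_le e) (Nat.cast_nonneg d))
  refine (mul_le_mul_of_nonneg_left h2 (by positivity)).trans (le_of_eq ?_)
  ring

/-- Expected slope under the Bernoulli product measure. -/
noncomputable def meanSlope (q : ℝ) (e : E) : ℝ :=
  ∑ k, if e ∈ D.supp k then D.coeff k * q ^ (#(D.supp k) - 1) else 0

/-- Expected row sum under the Bernoulli product measure. -/
noncomputable def meanRow (q : ℝ) (e : E) : ℝ :=
  ∑ k, if e ∈ D.supp k then
    D.coeff k * ((#(D.supp k) - 1 : ℕ) * q ^ (#(D.supp k) - 2)) else 0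

lemma resampleList_slope (q : ℝ) (e : E) :
    resampleList q (Finset.univ : Finset E).toList (D.slope e) = fun _ => D.meanSlope q e := by
  have h1 : D.slope e = fun x => ∑ k, (if e ∈ D.supp k then D.coeff k else 0) *
      mon ((D.supp k).erase e) x := by
    funext x
    refine Finset.sum_congr rfl fun k _ => ?_
    split_ifs <;> simp
  rw [h1, resampleList_sum]
  funext x
  refine Finset.sum_congr rfl fun k _ => ?_
  rw [resampleList_const_mul, resampleList_univ_mon]
  split_ifs with he
  · rw [Finset.card_erase_of_mem he]
  · simp

lemma resampleList_row (q : ℝ) (e : E) :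
    resampleList q (Finset.univ : Finset E).toList (D.row e) = fun _ => D.meanRow q e := by
  have h1 : D.row e = fun x => ∑ k, (if e ∈ D.supp k then D.coeff k else 0) *
      ∑ f ∈ (D.supp k).erase e, mon (((D.supp k).erase e).erase f) x := by
    funext x
    refine Finset.sum_congr rfl fun k _ => ?_
    split_ifs <;> simp
  rw [h1, resampleList_sum]
  funext x
  refine Finset.sum_congr rfl fun k _ => ?_
  rw [resampleList_const_mul, resampleList_sum]
  split_ifs with he
  · have : ∀ f ∈ (D.supp k).erase e,
        resampleList q (Finset.univ : Finset E).toList (mon (((D.supp k).erase e).erase f)) x =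
          q ^ (#(D.supp k) - 2) := fun f hf => by
      rw [resampleList_univ_mon, Finset.card_erase_of_mem hf, Finset.card_erase_of_mem he,
        Nat.sub_sub]
    simp only []
    rw [Finset.sum_congr rfl this, Finset.sum_const, Finset.card_erase_of_mem he, nsmul_eq_mul]
  · simp

/-- Tail bound under the product measure, uniformly over the coordinates. -/
lemma resampleList_exceed_le {q σ a η lam M S : ℝ} (h0 : 0 ≤ q) (h1 : q ≤ 1)
    (hσ : σ = 1 ∨ σ = -1) (hlam : 0 ≤ lam) {F : E → (E → Bool) → ℝ} {m : E → ℝ}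
    (hm : ∀ e, resampleList q (Finset.univ : Finset E).toList (F e) = fun _ => m e)
    (hη : ∀ e, η ≤ σ * (a - m e)) (c : E → E → ℝ) (hc0 : ∀ e f, 0 ≤ c e f)
    (hc : ∀ e f x,
      |F e (Function.update x f true) - F e (Function.update x f false)| ≤ c e f)
    (hcM : ∀ e f, c e f ≤ M) (hlamM : lam * M ≤ 1) (hcS : ∀ e, ∑ f, c e f ^ 2 ≤ S)
    (x : E → Bool) :
    resampleList q (Finset.univ : Finset E).toList (exceed σ a F) x ≤
      Fintype.card E * Real.exp (-(lam * η) + lam ^ 2 * S) := by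
  have hσ2 : σ ^ 2 = 1 := by rcases hσ with rfl | rfl <;> norm_num
  have hσa : |σ| = 1 := by rcases hσ with rfl | rfl <;> norm_num
  have hle : ∀ x, exceed σ a F x ≤
      ∑ e, Real.exp (-(lam * σ * a)) * Real.exp ((lam * σ) * F e x) := by
    intro x
    unfold exceed
    split_ifs with h
    · obtain ⟨e, he⟩ := h
      refine le_trans ?_ (Finset.single_le_sum (fun e _ => by positivity) (Finset.mem_univ e))
      rw [← Real.exp_add]
      refine Real.one_le_exp ?_
      have := mul_nonneg hlam he.le
      linarith
    · exact Finset.sum_nonneg fun e _ => by positivity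
  refine (resampleList_mono h0 h1 _ hle x).trans ?_
  rw [resampleList_sum]
  have hb : ∀ e ∈ (Finset.univ : Finset E), resampleList q (Finset.univ : Finset E).toList
      (fun x => Real.exp (-(lam * σ * a)) * Real.exp ((lam * σ) * F e x)) x ≤
      Real.exp (-(lam * η) + lam ^ 2 * S) := by
    intro e _
    rw [resampleList_const_mul]
    have hl : ∀ f, |lam * σ| * c e f ≤ 1 := fun f => by
      rw [abs_mul, hσa, mul_one, abs_of_nonneg hlam]
      exact (mul_le_mul_of_nonneg_left (hcM e f) hlam).trans hlamM
    have key := resampleList_exp_le h0 h1 (c e) (hc0 e) (hc e) hl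
      (Finset.univ : Finset E).toList x
    rw [hm e, Finset.sum_map_toList] at key
    refine (mul_le_mul_of_nonneg_left key (Real.exp_pos _).le).trans ?_
    rw [← Real.exp_add]
    refine Real.exp_le_exp.2 ?_
    have e1 : (lam * σ) ^ 2 = lam ^ 2 := by rw [mul_pow, hσ2, mul_one]
    rw [e1]
    have e2 := mul_le_mul_of_nonneg_left (hη e) hlam
    have e3 := mul_le_mul_of_nonneg_left (hcS e) (sq_nonneg lam)
    linarith
  refine (Finset.sum_le_sum hb).trans (le_of_eq ?_)
  rw [Finset.sum_const, nsmul_eq_mul, Finset.card_univ]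

/-- If the slopes rarely exceed `a`, then a monotone family with product mean short of `b`
rarely exceeds `b`. -/
lemma avg_exceed_le {h : E → ℝ} {τ σ a b δ η lam M S : ℝ} (hh : ∀ e, |h e| ≤ τ)
    (hσ : σ = 1 ∨ σ = -1)
    (hδ : avg (D.weight h) (exceed σ a D.slope) ≤ δ)
    (hlam : 0 ≤ lam) {F : E → (E → Bool) → ℝ} {m : E → ℝ} (hF : ∀ e, Monotone (F e))
    (hm : ∀ e, resampleList (Phi (a + σ * τ)) (Finset.univ : Finset E).toList (F e) =
      fun _ => m e)
    (hη : ∀ e, η ≤ σ * (b - m e)) (c : E → E → ℝ) (hc0 : ∀ e f, 0 ≤ c e f)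
    (hc : ∀ e f x,
      |F e (Function.update x f true) - F e (Function.update x f false)| ≤ c e f)
    (hcM : ∀ e f, c e f ≤ M) (hlamM : lam * M ≤ 1) (hcS : ∀ e, ∑ f, c e f ^ 2 ≤ S) :
    avg (D.weight h) (exceed σ b F) ≤
      Fintype.card E * Real.exp (-(lam * η) + lam ^ 2 * S) + Fintype.card E * δ := by
  have hσ2 : σ ^ 2 = 1 := by rcases hσ with rfl | rfl <;> norm_num
  have hq0 := (Phi_pos (a + σ * τ)).le
  have hq1 := (Phi_lt_one (a + σ * τ)).le
  have hB : ∀ e x, 0 < σ * (D.rate h e x - Phi (a + σ * τ)) → 1 ≤ exceed σ a D.slope x := by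
    intro e x hpos
    have : ∃ e, 0 < σ * (D.slope e x - a) := by
      by_contra hno
      push Not at hno
      have h1 := hno e
      have h2 := abs_le.1 (hh e)
      refine absurd hpos (not_lt.2 ?_)
      rcases hσ with rfl | rfl
      · have : D.rate h e x ≤ Phi (a + 1 * τ) := Phi_mono (by linarith)
        linarith
      · have : Phi (a + -1 * τ) ≤ D.rate h e x := Phi_mono (by linarith)
        linarith
    unfold exceed
    rw [if_pos this]
  refine (D.avg_le_resampleList h hσ2 hq0 hq1 (fun x => (exceed_mem_Icc σ a D.slope x).1) hB hδ
    (Finset.univ : Finset E).toList (exceed_signMono hσ b hF) (exceed_mem_Icc σ b F)).trans ?_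
  rw [Finset.length_toList, Finset.card_univ]
  gcongr
  refine (avg_mono (D.weight_pos h) fun x =>
    resampleList_exceed_le hq0 hq1 hσ hlam hm hη c hc0 hc hcM hlamM hcS x).trans (le_of_eq ?_)
  exact avg_const (D.weight_pos h) _

end Tail

end Energy

namespace Energy

section Comparison

variable {E I : Type*} [Fintype I] [DecidableEq E] [Fintype E] (D : Energy E I)

lemma sum_slope_sub_le {x y : E → Bool} (hxy : x ≤ y) :
    ∑ e, (D.slope e y - D.slope e x) ≤ ∑ f, (ind (y f) - ind (x f)) * D.row f y := by
  have hL : ∑ e, (D.slope e y - D.slope e x) = ∑ k, ∑ e ∈ D.supp k,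
      D.coeff k * (mon ((D.supp k).erase e) y - mon ((D.supp k).erase e) x) := by
    simp only [slope, ← Finset.sum_sub_distrib]
    rw [Finset.sum_comm]
    refine Finset.sum_congr rfl fun k _ => ?_
    rw [← Finset.sum_filter_add_sum_filter_not Finset.univ (fun e => e ∈ D.supp k),
      Finset.sum_eq_zero (s := Finset.univ.filter fun e => e ∉ D.supp k), add_zero,
      Finset.filter_mem_eq_inter, Finset.univ_inter]
    · exact Finset.sum_congr rfl fun e he => by rw [if_pos he, if_pos he, mul_sub]
    · intro e he
      rw [if_neg (Finset.mem_filter.1 he).2, if_neg (Finset.mem_filter.1 he).2, sub_zero]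
  have hR : ∑ f, (ind (y f) - ind (x f)) * D.row f y = ∑ k, ∑ f ∈ D.supp k,
      D.coeff k * ((ind (y f) - ind (x f)) *
        ∑ e ∈ (D.supp k).erase f, mon (((D.supp k).erase f).erase e) y) := by
    simp only [row, Finset.mul_sum (Finset.univ : Finset I)]
    rw [Finset.sum_comm]
    refine Finset.sum_congr rfl fun k _ => ?_
    rw [← Finset.sum_filter_add_sum_filter_not Finset.univ (fun e => e ∈ D.supp k),
      Finset.sum_eq_zero (s := Finset.univ.filter fun e => e ∉ D.supp k), add_zero,
      Finset.filter_mem_eq_inter, Finset.univ_inter]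
    · exact Finset.sum_congr rfl fun e he => by rw [if_pos he, mul_left_comm]
    · intro e he
      rw [if_neg (Finset.mem_filter.1 he).2, mul_zero]
  rw [hL, hR]
  refine Finset.sum_le_sum fun k _ => ?_
  rw [← Finset.mul_sum, ← Finset.mul_sum]
  refine mul_le_mul_of_nonneg_left ?_ (D.coeff_nonneg k)
  refine (Finset.sum_le_sum fun e _ => mon_sub_le ((D.supp k).erase e) hxy).trans (le_of_eq ?_)
  simp only [Finset.mul_sum]
  rw [Finset.sum_comm' (s' := fun f => (D.supp k).erase f) (t' := D.supp k)]
  · refine Finset.sum_congr rfl fun f _ => Finset.sum_congr rfl fun e _ => ?_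
    rw [Finset.erase_right_comm]
  · intro e f
    simp only [Finset.mem_erase]
    constructor
    · rintro ⟨h1, h2, h3⟩; exact ⟨⟨Ne.symm h2, h1⟩, h3⟩
    · rintro ⟨⟨h1, h2⟩, h3⟩; exact ⟨h2, Ne.symm h1, h3⟩

lemma avg_ind_eq_avg_rate (h : E → ℝ) (e : E) :
    avg (D.weight h) (fun x => ind (x e)) = avg (D.weight h) (D.rate h e) := by
  rw [D.avg_gibbs h e]
  simp [ind_true, ind_false]

open scoped Classical in
/-- Comparison of averages for a function that is increasing on a set of large probability. -/
lemma avg_le_avg_of_monoOn {h h' : E → ℝ} (hh : ∀ e, h e ≤ h' e) {Γ : Set (E → Bool)}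
    {L : (E → Bool) → ℝ} {M δ : ℝ} (hL0 : ∀ x, 0 ≤ L x) (hLM : ∀ x, L x ≤ M)
    (hL : MonotoneOn L Γ)
    (hδ : avg (D.weight h) (fun x => if x ∈ Γ then 0 else 1) ≤ δ)
    (hδ' : avg (D.weight h') (fun x => if x ∈ Γ then 0 else 1) ≤ δ) :
    avg (D.weight h) L ≤ avg (D.weight h') L + 2 * (M * δ) := by
  have hM : 0 ≤ M := (hL0 fun _ => false).trans (hLM _)
  set g : (E → Bool) → (E → Bool) → ℝ := fun x y => if y ∈ Γ ∧ y ≤ x then L y else 0 with hg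
  set L' : (E → Bool) → ℝ := fun x => Finset.univ.sup' Finset.univ_nonempty (g x) with hL'
  have hg0 : ∀ x y, 0 ≤ g x y := fun x y => by
    simp only [hg]; split_ifs
    · exact hL0 y
    · exact le_rfl
  have hgM : ∀ x y, g x y ≤ M := fun x y => by
    simp only [hg]; split_ifs
    · exact hLM y
    · exact hM
  have h0 : ∀ x, 0 ≤ L' x := fun x =>
    (hg0 x x).trans (Finset.le_sup' (g x) (Finset.mem_univ x))
  have h1 : ∀ x, L' x ≤ M := fun x => Finset.sup'_le _ _ fun y _ => hgM x y
  have hmono : Monotone L' := fun x x' hx => Finset.sup'_le _ _ fun y _ => by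
    refine le_trans ?_ (Finset.le_sup' (g x') (Finset.mem_univ y))
    simp only [hg]
    by_cases hy : y ∈ Γ ∧ y ≤ x
    · rw [if_pos hy, if_pos ⟨hy.1, hy.2.trans hx⟩]
    · rw [if_neg hy]; exact hg0 x' y
  have heq : ∀ x ∈ Γ, L' x = L x := fun x hx => by
    apply le_antisymm
    · refine Finset.sup'_le _ _ fun y _ => ?_
      simp only [hg]; split_ifs with hy
      · exact hL hy.1 hx hy.2
      · exact hL0 x
    · refine le_trans ?_ (Finset.le_sup' (g x) (Finset.mem_univ x))
      simp [hg, hx]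
  have c1 : avg (D.weight h) L ≤
      avg (D.weight h) (fun x => L' x + M * if x ∈ Γ then 0 else 1) :=
    avg_mono (D.weight_pos h) fun x => by
      split_ifs with hx
      · rw [heq x hx]; simp
      · linarith [hLM x, h0 x]
  have c2 : avg (D.weight h') L' ≤
      avg (D.weight h') (fun x => L x + M * if x ∈ Γ then 0 else 1) :=
    avg_mono (D.weight_pos h') fun x => by
      split_ifs with hx
      · rw [heq x hx]; simp
      · linarith [h1 x, hL0 x]
  rw [avg_add, avg_const_mul] at c1 c2
  have c3 := D.avg_weight_mono hh h0 hmono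
  have c4 := mul_le_mul_of_nonneg_left hδ hM
  have c5 := mul_le_mul_of_nonneg_left hδ' hM
  linarith

open scoped Classical in
/-- Contraction: the total change of the one-point functions under a change of the external
field is controlled by the total field. -/
lemma sum_avg_ind_sub_le {h h' : E → ℝ} (hh : ∀ e, h e ≤ h' e) {Γ : Set (E → Bool)}
    {u v ρ Λ κ δ : ℝ} (hΛ : ∀ z ∈ Set.Icc u v, Phi z * (1 - Phi z) ≤ Λ) (hΛ0 : 0 ≤ Λ)
    (hκ0 : 0 ≤ κ) (hκ1 : κ ≤ 1) (hκ : Λ * ρ ≤ 1 - κ)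
    (hΓ : ∀ x ∈ Γ, ∀ e, D.slope e x ∈ Set.Icc u v ∧ D.row e x ≤ ρ)
    (hδ : avg (D.weight h) (fun x => if x ∈ Γ then 0 else 1) ≤ δ)
    (hδ' : avg (D.weight h') (fun x => if x ∈ Γ then 0 else 1) ≤ δ) :
    κ * ∑ e, (avg (D.weight h') (fun x => ind (x e)) - avg (D.weight h) (fun x => ind (x e))) ≤
      ∑ e, (|h e| + |h' e|) + 4 * (Fintype.card E * δ) := by
  set N : ℝ := (Fintype.card E : ℝ) with hN
  set W : (E → Bool) → ℝ := fun x => ∑ e, Phi (D.slope e x) with hW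
  set L : (E → Bool) → ℝ := fun x => N + ((1 - κ) * ∑ e, ind (x e) - W x) with hLdef
  have hsum : ∀ x : E → Bool, ∑ e, ind (x e) ≤ N := fun x => by
    refine (Finset.sum_le_sum fun e _ => ind_le_one (x e)).trans ?_
    simp [hN]
  have hsum0 : ∀ x : E → Bool, 0 ≤ ∑ e, ind (x e) := fun x =>
    Finset.sum_nonneg fun e _ => ind_nonneg _
  have hW1 : ∀ x, W x ≤ N := fun x => by
    refine (Finset.sum_le_sum fun e _ => (Phi_lt_one (D.slope e x)).le).trans ?_
    simp [hN]
  have hW0 : ∀ x, 0 ≤ W x := fun x => Finset.sum_nonneg fun e _ => (Phi_pos _).le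
  have hL0 : ∀ x, 0 ≤ L x := fun x => by
    have := mul_nonneg (sub_nonneg.2 hκ1) (hsum0 x)
    simp only [hLdef]
    linarith [hW1 x]
  have hL1 : ∀ x, L x ≤ 2 * N := fun x => by
    have := mul_le_mul_of_nonneg_left (hsum x) (sub_nonneg.2 hκ1)
    have h2 : 0 ≤ κ * N := mul_nonneg hκ0 (Nat.cast_nonneg _)
    simp only [hLdef]
    linarith [hW0 x]
  have hL : MonotoneOn L Γ := by
    intro x hx y hy hxy
    have b1 : W y - W x ≤ ∑ e, Λ * (D.slope e y - D.slope e x) := by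
      simp only [hW]
      rw [← Finset.sum_sub_distrib]
      refine Finset.sum_le_sum fun e _ => Phi_sub_le (D.slope_mono e hxy) fun z hz => hΛ z ?_
      exact ⟨((hΓ x hx e).1).1.trans hz.1, hz.2.trans ((hΓ y hy e).1).2⟩
    have b2 : ∑ f, (ind (y f) - ind (x f)) * D.row f y ≤
        ∑ f, (ind (y f) - ind (x f)) * ρ :=
      Finset.sum_le_sum fun f _ => mul_le_mul_of_nonneg_left (hΓ y hy f).2
        (sub_nonneg.2 (ind_mono (hxy f)))
    have b3 := mul_le_mul_of_nonneg_left ((D.sum_slope_sub_le hxy).trans b2) hΛ0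
    have b4 : 0 ≤ ∑ f, (ind (y f) - ind (x f)) :=
      Finset.sum_nonneg fun f _ => sub_nonneg.2 (ind_mono (hxy f))
    have b5 := mul_le_mul_of_nonneg_right hκ b4
    rw [← Finset.sum_mul] at b3
    rw [← Finset.mul_sum] at b1
    have b6 : ∑ f, (ind (y f) - ind (x f)) = ∑ f, ind (y f) - ∑ f, ind (x f) :=
      Finset.sum_sub_distrib _ _
    rw [b6] at b3 b5
    simp only [hLdef]
    nlinarith
  have main := D.avg_le_avg_of_monoOn hh hL0 hL1 hL hδ hδ'
  have hLavg : ∀ g : E → ℝ, avg (D.weight g) L =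
      N + ((1 - κ) * ∑ e, avg (D.weight g) (fun x => ind (x e)) - avg (D.weight g) W) := by
    intro g
    simp only [hLdef]
    rw [avg_add, avg_const (D.weight_pos g), avg_sub, avg_const_mul, avg_sum]
  rw [hLavg, hLavg] at main
  have hrate : ∀ g : E → ℝ,
      |∑ e, avg (D.weight g) (fun x => ind (x e)) - avg (D.weight g) W| ≤ ∑ e, |g e| := by
    intro g
    simp only [hW]
    rw [avg_sum, ← Finset.sum_sub_distrib]
    refine (Finset.abs_sum_le_sum_abs _ _).trans (Finset.sum_le_sum fun e _ => ?_)
    rw [avg_ind_eq_avg_rate, ← avg_sub]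
    refine (abs_avg_le (D.weight_pos g)).trans ?_
    refine (avg_mono (G := fun _ => |g e|) (D.weight_pos g) fun x => ?_).trans
      (avg_const (D.weight_pos g) _).le
    refine (abs_Phi_sub_le _ _).trans ?_
    rw [add_sub_cancel_left]
  have r1 := (abs_le.1 (hrate h)).1
  have r2 := (abs_le.1 (hrate h')).2
  rw [Finset.sum_sub_distrib, Finset.sum_add_distrib]
  nlinarith

/-- Exponential moment bound for the number of present edges in a finite set, given a bound
for the response to an external field. -/
lemma avg_exp_sum_le {B : Finset E} {t A : ℝ} (s : ℝ) (hst : |s| = t)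
    (hA : ∀ h h' : E → ℝ, (∀ e, h e ≤ h' e) → (∀ e, |h e| ≤ t) → (∀ e, |h' e| ≤ t) →
      (∀ e ∉ B, h e = 0 ∧ h' e = 0) →
      ∑ e, (avg (D.weight h') (fun x => ind (x e)) - avg (D.weight h) (fun x => ind (x e))) ≤ A) :
    avg (D.weight 0) (fun x => Real.exp (s * ∑ e ∈ B,
      (ind (x e) - avg (D.weight 0) fun x => ind (x e)))) ≤ Real.exp (t * A) := by
  set μ : E → ℝ := fun e => avg (D.weight 0) fun x => ind (x e) with hμ
  set g : E → ℝ := fun e => if e ∈ B then s else 0 with hg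
  have ht : 0 ≤ t := hst ▸ abs_nonneg s
  refine (avg_exp_le_exp_avg_tilt (D.weight_pos 0)).trans (Real.exp_le_exp.2 ?_)
  have hw : ∀ F : (E → Bool) → ℝ, avg (fun x => D.weight 0 x *
      Real.exp (s * ∑ e ∈ B, (ind (x e) - μ e))) F = avg (D.weight g) F := by
    intro F
    have e1 : ∀ x, D.weight 0 x * Real.exp (s * ∑ e ∈ B, (ind (x e) - μ e)) =
        Real.exp (-(s * ∑ e ∈ B, μ e)) * D.weight g x := by
      intro x
      have : ∑ e, g e * ind (x e) = s * ∑ e ∈ B, ind (x e) := by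
        simp only [hg, ite_mul, zero_mul]
        rw [Finset.sum_ite_mem, Finset.univ_inter, Finset.mul_sum]
      simp only [weight, this]
      rw [← Real.exp_add, ← Real.exp_add, Finset.sum_sub_distrib]
      simp only [Pi.zero_apply, zero_mul, Finset.sum_const_zero]
      congr 1; ring
    unfold avg
    simp only [e1, mul_assoc, ← Finset.mul_sum]
    exact mul_div_mul_left _ _ (Real.exp_pos _).ne'
  rw [hw, avg_const_mul, avg_sum]
  have e2 : ∀ e, avg (D.weight g) (fun x => ind (x e) - μ e) =
      avg (D.weight g) (fun x => ind (x e)) - μ e := fun e => by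
    rw [avg_sub, avg_const (D.weight_pos g)]
  rw [Finset.sum_congr rfl fun e _ => e2 e]
  have hind : ∀ (h h' : E → ℝ), (∀ e, h e ≤ h' e) → ∀ e,
      0 ≤ avg (D.weight h') (fun x => ind (x e)) - avg (D.weight h) (fun x => ind (x e)) :=
    fun h h' hh e => sub_nonneg.2 <|
      D.avg_weight_mono hh (fun x => ind_nonneg _) fun x y hxy => ind_mono (hxy e)
  have hgt : ∀ e, |g e| ≤ t := fun e => by
    simp only [hg]; split_ifs
    · exact hst.le
    · simpa using ht
  have hgB : ∀ e ∉ B, g e = 0 := fun e he => by simp [hg, he]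
  have h0t : ∀ e : E, |(0 : E → ℝ) e| ≤ t := fun e => by simpa using ht
  rcases le_total 0 s with hs | hs
  · have hst' : s = t := by rw [← hst, abs_of_nonneg hs]
    have hle : ∀ e, (0 : E → ℝ) e ≤ g e := fun e => by
      simp only [hg, Pi.zero_apply]; split_ifs
      · exact hs
      · exact le_rfl
    rw [hst']
    refine mul_le_mul_of_nonneg_left ?_ ht
    refine (Finset.sum_le_sum_of_subset_of_nonneg (Finset.subset_univ B)
      fun e _ _ => hind 0 g hle e).trans ?_
    exact hA 0 g hle h0t hgt fun e he => ⟨rfl, hgB e he⟩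
  · have hst' : s = -t := by rw [← hst, abs_of_nonpos hs, neg_neg]
    have hle : ∀ e, g e ≤ (0 : E → ℝ) e := fun e => by
      simp only [hg, Pi.zero_apply]; split_ifs
      · exact hs
      · exact le_rfl
    rw [hst', neg_mul, ← mul_neg, ← Finset.sum_neg_distrib]
    refine mul_le_mul_of_nonneg_left ?_ ht
    simp only [neg_sub]
    refine (Finset.sum_le_sum_of_subset_of_nonneg (Finset.subset_univ B)
      fun e _ _ => hind g 0 hle e).trans ?_
    exact hA g 0 hle hgt h0t fun e he => ⟨hgB e he, rfl⟩

end Comparison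

end Energy

namespace Energy

section Bootstrap

variable {E I : ℕ → Type*} [∀ n, Fintype (I n)] [∀ n, DecidableEq (E n)] [∀ n, Fintype (E n)]

/-- Under every sufficiently small external field, some member of the family `F` exceeds the
level `a` (in the direction `σ`) only with superpolynomially small probability. -/
def Rare (D : ∀ n, Energy (E n) (I n)) (σ a : ℝ) (F : ∀ n, E n → (E n → Bool) → ℝ) : Prop :=
  ∀ A : ℕ, ∃ τ > 0, ∃ N : ℕ, ∀ n, N ≤ n → ∀ h : E n → ℝ, (∀ e, |h e| ≤ τ) →
    avg ((D n).weight h) (exceed σ a (F n)) * (n : ℝ) ^ A ≤ 1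

variable {D : ∀ n, Energy (E n) (I n)}

lemma exceed_anti {X : Type*} {σ a b : ℝ} (hab : σ * a ≤ σ * b) (F : X → (X → Bool) → ℝ)
    (x : X → Bool) : exceed σ b F x ≤ exceed σ a F x := by
  unfold exceed
  by_cases h : ∃ e, 0 < σ * (F e x - b)
  · obtain ⟨e, he⟩ := h
    rw [if_pos ⟨e, he⟩, if_pos ⟨e, by linarith⟩]
  · rw [if_neg h]
    split_ifs <;> norm_num

lemma Rare.mono {σ a b : ℝ} {F : ∀ n, E n → (E n → Bool) → ℝ} (ha : Rare D σ a F)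
    (hab : σ * a ≤ σ * b) : Rare D σ b F := by
  intro A
  obtain ⟨τ, hτ, N, hN⟩ := ha A
  refine ⟨τ, hτ, N, fun n hn h hh => le_trans ?_ (hN n hn h hh)⟩
  exact mul_le_mul_of_nonneg_right
    (avg_mono ((D n).weight_pos h) fun x => exceed_anti hab (F n) x) (by positivity)

lemma rare_of_forall_le {σ a : ℝ} {F : ∀ n, E n → (E n → Bool) → ℝ}
    (hF : ∀ n e x, 1 ≤ n → σ * (F n e x - a) ≤ 0) : Rare D σ a F := by
  intro A
  refine ⟨1, one_pos, 1, fun n hn h _ => ?_⟩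
  have : avg ((D n).weight h) (exceed σ a (F n)) = 0 := by
    have h0 : exceed σ a (F n) = fun _ => 0 := by
      funext x
      unfold exceed
      rw [if_neg]
      push Not
      exact fun e => hF n e x hn
    rw [h0, avg_const ((D n).weight_pos h)]
  rw [this, zero_mul]
  exact zero_le_one

lemma exists_pow_mul_exp_le (A : ℕ) {γ ε : ℝ} (hγ : 0 < γ) (hε : 0 < ε) :
    ∃ N : ℕ, ∀ n : ℕ, N ≤ n → (n : ℝ) ^ A * Real.exp (-(γ * n)) ≤ ε := by
  have h1 := (Real.tendsto_pow_mul_exp_neg_atTop_nhds_zero A).comp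
    ((tendsto_natCast_atTop_atTop (R := ℝ)).const_mul_atTop hγ)
  have h2 := h1.const_mul ((γ ^ A)⁻¹)
  rw [mul_zero] at h2
  have h3 := h2.eventually (gt_mem_nhds hε)
  obtain ⟨N, hN⟩ := eventually_atTop.1 h3
  refine ⟨N, fun n hn => le_trans (le_of_eq ?_) (hN n hn).le⟩
  simp only [Function.comp]
  rw [mul_pow]
  field_simp

/-- One step of the bootstrap: if the slopes rarely exceed `a`, then a family whose product
mean at density `Phi a` falls short of `b` rarely exceeds `b`. -/
lemma Rare.step {σ a b M S : ℝ} (hσ : σ = 1 ∨ σ = -1)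
    (hcard : ∀ n, (Fintype.card (E n) : ℝ) ≤ (n : ℝ) ^ 2)
    (ha : Rare D σ a fun n => (D n).slope)
    {F : ∀ n, E n → (E n → Bool) → ℝ} {μ : ∀ n, ℝ → E n → ℝ} {ψ : ℝ → ℝ}
    (hF : ∀ n e, Monotone (F n e))
    (hμ : ∀ n q e, resampleList q (Finset.univ : Finset (E n)).toList (F n e) = fun _ => μ n q e)
    (hψ : Continuous ψ)
    (hlim : ∀ ε > 0, ∃ N : ℕ, ∀ n, N ≤ n → ∀ q ∈ Set.Icc (0 : ℝ) 1, ∀ e, |μ n q e - ψ q| ≤ ε)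
    (hb : 0 < σ * (b - ψ (Phi a))) (c : ∀ n, E n → E n → ℝ) (hc0 : ∀ n e f, 0 ≤ c n e f)
    (hc : ∀ n, 1 ≤ n → ∀ e f x,
      |F n e (Function.update x f true) - F n e (Function.update x f false)| ≤ c n e f)
    (hM : 0 ≤ M) (hS : 0 ≤ S) (hcM : ∀ n, 1 ≤ n → ∀ e f, c n e f ≤ M / n)
    (hcS : ∀ n, 1 ≤ n → ∀ e, ∑ f, c n e f ^ 2 ≤ S / n) : Rare D σ b F := by
  intro A
  set η : ℝ := σ * (b - ψ (Phi a)) / 3 with hη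
  have hη0 : 0 < η := by positivity
  have habs : ∀ r : ℝ, |σ * r| = |r| := fun r => by
    rcases hσ with rfl | rfl <;> simp
  have hcont : ContinuousAt (fun τ => ψ (Phi (a + σ * τ))) 0 :=
    (hψ.comp (continuous_Phi.comp (by fun_prop))).continuousAt
  obtain ⟨τ₀, hτ₀, hclose⟩ := Metric.continuousAt_iff.1 hcont η hη0
  obtain ⟨τ₁, hτ₁, N₁, hN₁⟩ := ha (A + 3)
  obtain ⟨N₂, hN₂⟩ := hlim η hη0
  set θ : ℝ := min (η / (2 * (S + 1))) (1 / (M + 1)) with hθ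
  have hθ0 : 0 < θ := lt_min (by positivity) (by positivity)
  have hθS : θ * S ≤ η / 2 := by
    have h1 : θ * (S + 1) ≤ η / (2 * (S + 1)) * (S + 1) :=
      mul_le_mul_of_nonneg_right (min_le_left _ _) (by positivity)
    have h2 : η / (2 * (S + 1)) * (S + 1) = η / 2 := by field_simp
    nlinarith
  have hθM : θ * M ≤ 1 := by
    have h1 : θ * (M + 1) ≤ 1 / (M + 1) * (M + 1) :=
      mul_le_mul_of_nonneg_right (min_le_right _ _) (by positivity)
    have h2 : 1 / (M + 1) * (M + 1) = 1 := by field_simp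
    nlinarith
  obtain ⟨N₃, hN₃⟩ := exists_pow_mul_exp_le (A + 2) (γ := θ * η / 2) (ε := 1 / 2)
    (by positivity) (by norm_num)
  refine ⟨min (τ₀ / 2) τ₁, lt_min (by positivity) hτ₁, max (max N₁ N₂) (max N₃ 2),
    fun n hn h hh => ?_⟩
  simp only [max_le_iff] at hn
  obtain ⟨⟨hn1, hn2⟩, hn3, hn4⟩ := hn
  have hnpos : (0 : ℝ) < n := by exact_mod_cast (by omega : 0 < n)
  have hn2' : (2 : ℝ) ≤ n := by exact_mod_cast hn4
  set τ := min (τ₀ / 2) τ₁ with hτ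
  have hτpos : 0 < τ := lt_min (by positivity) hτ₁
  set q := Phi (a + σ * τ) with hq
  have hψq : |ψ q - ψ (Phi a)| < η := by
    have h1 : dist τ 0 < τ₀ := by
      rw [Real.dist_eq, sub_zero, abs_of_pos hτpos]
      exact (min_le_left _ _).trans_lt (by linarith)
    have := hclose h1
    simpa [Real.dist_eq] using this
  have hδ := hN₁ n hn1 h fun e => (hh e).trans (min_le_right _ _)
  set δ := avg ((D n).weight h) (exceed σ a (D n).slope) with hδdef
  have hgap : ∀ e, η ≤ σ * (b - μ n q e) := by
    intro e
    have h1 := hN₂ n hn2 q ⟨(Phi_pos _).le, (Phi_lt_one _).le⟩ e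
    rw [← habs] at h1 hψq
    have h2 := (abs_le.1 h1).2
    have h3 := (abs_lt.1 hψq).2
    have h4 : σ * (b - ψ (Phi a)) = 3 * η := by rw [hη]; ring
    linarith
  have main := (D n).avg_exceed_le (lam := θ * n) hh hσ hδdef.ge (by positivity) (hF n)
    (fun e => hμ n q e) hgap (c n) (hc0 n) (hc n (by omega)) (hcM n (by omega))
    (by rw [mul_assoc, mul_div_cancel₀ _ hnpos.ne']; exact hθM) (hcS n (by omega))
  have hexp : -(θ * n * η) + (θ * n) ^ 2 * (S / n) ≤ -(θ * η / 2 * n) := by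
    have h1 : (θ * n) ^ 2 * (S / n) = θ * n * (θ * S) := by field_simp
    rw [h1]
    nlinarith [mul_le_mul_of_nonneg_left hθS (mul_pos hθ0 hnpos).le]
  have hδ0 : 0 ≤ δ := avg_nonneg ((D n).weight_pos h) fun x => (exceed_mem_Icc _ _ _ _).1
  calc avg ((D n).weight h) (exceed σ b (F n)) * (n : ℝ) ^ A
      ≤ ((n : ℝ) ^ 2 * Real.exp (-(θ * η / 2 * n)) + (n : ℝ) ^ 2 * δ) * (n : ℝ) ^ A := by
        refine mul_le_mul_of_nonneg_right (main.trans (add_le_add ?_ ?_)) (by positivity)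
        · exact mul_le_mul (hcard n) (Real.exp_le_exp.2 hexp) (Real.exp_pos _).le (by positivity)
        · exact mul_le_mul_of_nonneg_right (hcard n) hδ0
    _ = (n : ℝ) ^ (A + 2) * Real.exp (-(θ * η / 2 * n)) + δ * (n : ℝ) ^ (A + 3) / n := by
        field_simp
        ring
    _ ≤ 1 / 2 + 1 / 2 := by
        refine add_le_add (hN₃ n hn3) ?_
        rw [div_le_iff₀ hnpos]
        linarith
    _ = 1 := by norm_num

/-- Data describing the mean field limit of a sequence of energies: `ψ` is the limiting slope
and `ψ'` the limiting row sum at a given density. -/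
structure MeanField (D : ∀ n, Energy (E n) (I n)) (d : ℕ) (K : ℝ) (ψ ψ' : ℝ → ℝ) : Prop where
  K_nonneg : 0 ≤ K
  sparse : ∀ n, 1 ≤ n → (D n).Sparse d K n
  card_le : ∀ n, (Fintype.card (E n) : ℝ) ≤ (n : ℝ) ^ 2
  continuous_slope : Continuous ψ
  continuous_row : Continuous ψ'
  slope_lim : ∀ ε > 0, ∃ N : ℕ, ∀ n, N ≤ n → ∀ q ∈ Set.Icc (0 : ℝ) 1, ∀ e,
    |(D n).meanSlope q e - ψ q| ≤ ε
  row_lim : ∀ ε > 0, ∃ N : ℕ, ∀ n, N ≤ n → ∀ q ∈ Set.Icc (0 : ℝ) 1, ∀ e,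
    |(D n).meanRow q e - ψ' q| ≤ ε

lemma Sparse.slope_le {X Y : Type*} [Fintype Y] [DecidableEq X] {D : Energy X Y} {d : ℕ}
    {K ν : ℝ} (hD : D.Sparse d K ν) (e : X) (x : X → Bool) : D.slope e x ≤ K := by
  refine le_trans (Finset.sum_le_sum fun k _ => ?_) (hD.degree_le e)
  split_ifs
  · exact mul_le_of_le_one_right (D.coeff_nonneg k) (mon_le_one _ _)
  · exact le_rfl

variable {d : ℕ} {K : ℝ} {ψ ψ' : ℝ → ℝ}

lemma MeanField.rare_slope_step (hD : MeanField D d K ψ ψ') {σ a b : ℝ} (hσ : σ = 1 ∨ σ = -1)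
    (ha : Rare D σ a fun n => (D n).slope) (hb : 0 < σ * (b - ψ (Phi a))) :
    Rare D σ b fun n => (D n).slope := by
  have hK := hD.K_nonneg
  refine ha.step (M := K) (S := d * K ^ 2) hσ hD.card_le (fun n e => (D n).slope_mono e)
    (fun n q e => (D n).resampleList_slope q e) hD.continuous_slope hD.slope_lim hb
    (fun n => (D n).influence) (fun n => (D n).influence_nonneg)
    (fun n _ => (D n).slope_influence) hK (by positivity) ?_ ?_
  · exact fun n hn => (hD.sparse n hn).influence_le (by exact_mod_cast hn) hK
  · exact fun n hn => (hD.sparse n hn).sum_influence_sq_le (by exact_mod_cast hn) hK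

lemma MeanField.rare_row_step (hD : MeanField D d K ψ ψ') {σ a b : ℝ} (hσ : σ = 1 ∨ σ = -1)
    (ha : Rare D σ a fun n => (D n).slope) (hb : 0 < σ * (b - ψ' (Phi a))) :
    Rare D σ b fun n => (D n).row := by
  have hK := hD.K_nonneg
  refine ha.step (M := d * K) (S := d ^ 2 * (d * K ^ 2)) hσ hD.card_le
    (fun n e => (D n).row_mono e)
    (fun n q e => (D n).resampleList_row q e) hD.continuous_row hD.row_lim hb
    (fun n e f => d * (D n).influence e f)
    (fun n e f => mul_nonneg (Nat.cast_nonneg _) ((D n).influence_nonneg e f))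
    (fun n hn => (D n).row_influence (hD.sparse n hn).card_le) (by positivity) (by positivity) ?_ ?_
  · intro n hn e f
    rw [mul_div_assoc]
    exact mul_le_mul_of_nonneg_left
      ((hD.sparse n hn).influence_le (by exact_mod_cast hn) hK e f) (Nat.cast_nonneg _)
  · intro n hn e
    simp only [mul_pow]
    rw [← Finset.mul_sum, mul_div_assoc]
    exact mul_le_mul_of_nonneg_left
      ((hD.sparse n hn).sum_influence_sq_le (by exact_mod_cast hn) hK e) (by positivity)

/-- The slopes concentrate on the side `σ` of a level `a` as soon as the mean field map has no
further fixed level on that side. -/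
lemma MeanField.rare_slope (hD : MeanField D d K ψ ψ') {σ a : ℝ} (hσ : σ = 1 ∨ σ = -1)
    (hg : ∀ ε > 0, σ * (ψ (Phi (a + σ * ε)) - a) < ε) {ε : ℝ} (hε : 0 < ε) :
    Rare D σ (a + σ * ε) fun n => (D n).slope := by
  have hσσ : σ * σ = 1 := by rcases hσ with rfl | rfl <;> norm_num
  set T : Set ℝ := {ε | 0 < ε ∧ Rare D σ (a + σ * ε) fun n => (D n).slope} with hT
  have hmono : ∀ u ∈ T, ∀ v, u ≤ v → v ∈ T := by
    rintro u ⟨hu0, hu⟩ v huv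
    refine ⟨hu0.trans_le huv, hu.mono ?_⟩
    nlinarith
  have hne : T.Nonempty := by
    have hK := hD.K_nonneg
    refine ⟨K + |a| + 1, by positivity, rare_of_forall_le fun n e x hn => ?_⟩
    have h1 := (hD.sparse n hn).slope_le e x
    have h2 := (D n).slope_nonneg e x
    have h3 : σ * ((D n).slope e x - (a + σ * (K + |a| + 1))) =
      σ * ((D n).slope e x - a) - (K + |a| + 1) := by linear_combination -(K + |a| + 1) * hσσ
    rw [h3]
    have h4 := neg_abs_le a
    have h5 := le_abs_self a
    rcases hσ with rfl | rfl <;> linarith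
  have hbdd : BddBelow T := ⟨0, fun u hu => hu.1.le⟩
  have hc0 : 0 ≤ sInf T := le_csInf hne fun u hu => hu.1.le
  rcases hc0.eq_or_lt with hc | hc
  · obtain ⟨u, hu, huε⟩ := exists_lt_of_csInf_lt hne (hc ▸ hε : sInf T < ε)
    exact (hmono u hu ε huε.le).2
  · exfalso
    set c := sInf T with hcdef
    have hlt := hg c hc
    have hcont : Continuous fun u => σ * (ψ (Phi (a + σ * u)) - a) := by
      have := hD.continuous_slope.comp (continuous_Phi.comp
        (by fun_prop : Continuous fun u : ℝ => a + σ * u))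
      exact continuous_const.mul (this.sub continuous_const)
    obtain ⟨w, hw1, hw2⟩ := exists_between (max_lt hlt hc)
    have hev := (hcont.tendsto c).eventually (gt_mem_nhds ((le_max_left _ _).trans_lt hw1))
    obtain ⟨r, hr, hball⟩ := Metric.eventually_nhds_iff.1 hev
    obtain ⟨u, hu, hur⟩ := exists_lt_of_csInf_lt hne (by linarith : sInf T < c + r)
    have hcu : c ≤ u := csInf_le hbdd hu
    have hval := hball (y := u) (by rw [Real.dist_eq, abs_of_nonneg (by linarith)]; linarith)
    have hwT : w ∈ T := by
      refine ⟨(le_max_right _ _).trans_lt hw1, hD.rare_slope_step hσ hu.2 ?_⟩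
      have : σ * (a + σ * w - ψ (Phi (a + σ * u))) = w - σ * (ψ (Phi (a + σ * u)) - a) := by
        linear_combination w * hσσ
      rw [this]
      linarith
    exact absurd (csInf_le hbdd hwT) (not_le.2 hw2)

lemma signed_gap_of_unique {ψ : ℝ → ℝ} (hψ : Continuous ψ) {K a σ : ℝ} (hσ : σ = 1 ∨ σ = -1)
    (hψK : ∀ q ∈ Set.Icc (0 : ℝ) 1, ψ q ∈ Set.Icc 0 K)
    (huniq : ∀ z, ψ (Phi z) = z → z = a) :
    ∀ ε > 0, σ * (ψ (Phi (a + σ * ε)) - a) < ε := by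
  intro ε hε
  by_contra hcon
  push Not at hcon
  have hσσ : σ * σ = 1 := by rcases hσ with rfl | rfl <;> norm_num
  set R : ℝ := ε + K + |a| + 1 with hR
  have hK : 0 ≤ K := (hψK 0 ⟨le_rfl, zero_le_one⟩).1.trans (hψK 0 ⟨le_rfl, zero_le_one⟩).2
  have hεR : ε ≤ R := by have := abs_nonneg a; linarith
  set g : ℝ → ℝ := fun u => σ * (ψ (Phi (a + σ * u)) - a) - u with hg
  have hcont : Continuous g := by
    have := hψ.comp (continuous_Phi.comp (by fun_prop : Continuous fun u : ℝ => a + σ * u))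
    exact (continuous_const.mul (this.sub continuous_const)).sub continuous_id
  have hgR : g R ≤ 0 := by
    have h1 := hψK (Phi (a + σ * R)) ⟨(Phi_pos _).le, (Phi_lt_one _).le⟩
    have h2 := h1.1
    have h3 := h1.2
    have h4 := neg_abs_le a
    have h5 := le_abs_self a
    simp only [hg]
    rcases hσ with rfl | rfl <;> linarith
  obtain ⟨u, hu, hgu⟩ := intermediate_value_Icc' hεR hcont.continuousOn
    (show (0 : ℝ) ∈ Set.Icc (g R) (g ε) from ⟨hgR, sub_nonneg.2 hcon⟩)
  have hfix : ψ (Phi (a + σ * u)) = a + σ * u := by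
    simp only [hg] at hgu
    linear_combination σ * hgu + (a - ψ (Phi (a + σ * u))) * hσσ
  have h0 := huniq _ hfix
  have hu0 : 0 < u := hε.trans_le hu.1
  rcases hσ with rfl | rfl <;> linarith

end Bootstrap

end Energy

namespace Energy

section Laplace

variable {E I : ℕ → Type*} [∀ n, Fintype (I n)] [∀ n, DecidableEq (E n)] [∀ n, Fintype (E n)]
  {D : ∀ n, Energy (E n) (I n)} {d : ℕ} {K : ℝ} {ψ ψ' : ℝ → ℝ}

open scoped Classical in
/-- With overwhelming probability, and uniformly over small external fields, all slopes are close
to the fixed level and all row sums are bounded by the limiting row sum plus a small error. -/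
lemma MeanField.exists_good_set (hD : MeanField D d K ψ ψ') {a ε ρ : ℝ}
    (hg : ∀ σ : ℝ, σ = 1 ∨ σ = -1 → ∀ ε > 0, σ * (ψ (Phi (a + σ * ε)) - a) < ε) (hε : 0 < ε)
    (hρ : ψ' (Phi (a + ε)) < ρ) :
    ∃ τ > 0, ∃ N : ℕ, ∀ n, N ≤ n → ∃ Γ : Set (E n → Bool),
      (∀ x ∈ Γ, ∀ e, (D n).slope e x ∈ Set.Icc (a - ε) (a + ε) ∧ (D n).row e x ≤ ρ) ∧
      ∀ h : E n → ℝ, (∀ e, |h e| ≤ τ) →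
        avg ((D n).weight h) (fun x => if x ∈ Γ then 0 else 1) * (n : ℝ) ^ 2 ≤ 3 := by
  have r1 : Rare D 1 (a + 1 * ε) fun n => (D n).slope :=
    hD.rare_slope (Or.inl rfl) (hg 1 (Or.inl rfl)) hε
  have r2 : Rare D (-1) (a + -1 * ε) fun n => (D n).slope :=
    hD.rare_slope (Or.inr rfl) (hg (-1) (Or.inr rfl)) hε
  have r3 : Rare D 1 ρ fun n => (D n).row :=
    hD.rare_row_step (Or.inl rfl) r1 (by rw [one_mul, one_mul]; linarith)
  obtain ⟨τ₁, hτ₁, N₁, h₁⟩ := r1 2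
  obtain ⟨τ₂, hτ₂, N₂, h₂⟩ := r2 2
  obtain ⟨τ₃, hτ₃, N₃, h₃⟩ := r3 2
  refine ⟨min τ₁ (min τ₂ τ₃), lt_min hτ₁ (lt_min hτ₂ hτ₃), max N₁ (max N₂ N₃), fun n hn => ?_⟩
  simp only [max_le_iff] at hn
  obtain ⟨Γ, hΓ⟩ : ∃ Γ : Set (E n → Bool), Γ =
      {x | ∀ e, (D n).slope e x ∈ Set.Icc (a - ε) (a + ε) ∧ (D n).row e x ≤ ρ} := ⟨_, rfl⟩
  refine ⟨Γ, fun x hx => by rw [hΓ] at hx; exact hx, fun h hh => ?_⟩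
  have b1 := h₁ n hn.1 h fun e => (hh e).trans (min_le_left _ _)
  have b2 := h₂ n hn.2.1 h fun e => (hh e).trans ((min_le_right _ _).trans (min_le_left _ _))
  have b3 := h₃ n hn.2.2 h fun e => (hh e).trans ((min_le_right _ _).trans (min_le_right _ _))
  beta_reduce at b1 b2 b3
  have key : avg ((D n).weight h) (fun x => if x ∈ Γ then 0 else 1) ≤
      avg ((D n).weight h) (fun x => exceed 1 (a + 1 * ε) (D n).slope x +
        (exceed (-1) (a + -1 * ε) (D n).slope x + exceed 1 ρ (D n).row x)) := by
    refine avg_mono ((D n).weight_pos h) fun x => ?_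
    have n1 := (exceed_mem_Icc 1 (a + 1 * ε) (D n).slope x).1
    have n2 := (exceed_mem_Icc (-1) (a + -1 * ε) (D n).slope x).1
    have n3 := (exceed_mem_Icc 1 ρ (D n).row x).1
    split_ifs with hx
    · positivity
    · simp only [hΓ, Set.mem_ofPred_eq, not_forall, Set.mem_Icc, not_and_or, not_le] at hx
      obtain ⟨e, (he | he) | he⟩ := hx
      · have : exceed (-1) (a + -1 * ε) (D n).slope x = 1 := if_pos ⟨e, by linarith⟩
        linarith
      · have : exceed 1 (a + 1 * ε) (D n).slope x = 1 := if_pos ⟨e, by linarith⟩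
        linarith
      · have : exceed 1 ρ (D n).row x = 1 := if_pos ⟨e, by linarith⟩
        linarith
  rw [avg_add, avg_add] at key
  have := mul_le_mul_of_nonneg_right key (by positivity : (0 : ℝ) ≤ (n : ℝ) ^ 2)
  linarith

/-- Uniform exponential moment bound, at scale `n^{-1/2}`, for sums of at most `n` centred edge
variables of a subcritical mean field sequence. -/
lemma MeanField.avg_exp_sum_le (hD : MeanField D d K ψ ψ') {a : ℝ}
    (hg : ∀ σ : ℝ, σ = 1 ∨ σ = -1 → ∀ ε > 0, σ * (ψ (Phi (a + σ * ε)) - a) < ε)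
    (hrow : 0 ≤ ψ' (Phi a)) (hcontr : Phi a * (1 - Phi a) * ψ' (Phi a) < 1) :
    ∃ C : ℝ, ∃ N : ℕ, ∀ n, N ≤ n → ∀ B : Finset (E n), #B ≤ n → ∀ s : ℝ, |s| = (√(n : ℝ))⁻¹ →
      avg ((D n).weight 0) (fun x => Real.exp (s * ∑ e ∈ B,
        (ind (x e) - avg ((D n).weight 0) fun x => ind (x e)))) ≤ C := by
  have hvar : 0 < Phi a * (1 - Phi a) := mul_pos (Phi_pos a) (sub_pos.2 (Phi_lt_one a))
  obtain ⟨η, hη, hηlt⟩ : ∃ η > 0, (Phi a * (1 - Phi a) + η) * (ψ' (Phi a) + η) < 1 := by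
    have hc : ContinuousAt (fun η : ℝ => (Phi a * (1 - Phi a) + η) * (ψ' (Phi a) + η)) 0 := by
      fun_prop
    have hev := hc.tendsto.eventually_lt_const (u := 1) (by simpa using hcontr)
    obtain ⟨r, hr, hball⟩ := Metric.eventually_nhds_iff.1 hev
    refine ⟨r / 2, by positivity, hball ?_⟩
    rw [Real.dist_eq, sub_zero, abs_of_pos (by positivity)]
    linarith
  set Λ := Phi a * (1 - Phi a) + η with hΛ
  set ρ := ψ' (Phi a) + η with hρ
  obtain ⟨ε, hε, hε1, hε2⟩ : ∃ ε > 0, (∀ z ∈ Set.Icc (a - ε) (a + ε), Phi z * (1 - Phi z) ≤ Λ) ∧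
      ψ' (Phi (a + ε)) < ρ := by
    have hc1 : ContinuousAt (fun z => Phi z * (1 - Phi z)) a :=
      (continuous_Phi.mul (continuous_const.sub continuous_Phi)).continuousAt
    have hc2 : ContinuousAt (fun z => ψ' (Phi z)) a :=
      (hD.continuous_row.comp continuous_Phi).continuousAt
    have hev := (hc1.tendsto.eventually_lt_const (u := Λ) (by linarith)).and
      (hc2.tendsto.eventually_lt_const (u := ρ) (by linarith))
    obtain ⟨r, hr, hball⟩ := Metric.eventually_nhds_iff.1 hev
    refine ⟨r / 2, by positivity, fun z hz => (hball ?_).1.le, (hball ?_).2⟩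
    · rw [Real.dist_eq, abs_lt]
      constructor <;> linarith [hz.1, hz.2]
    · rw [Real.dist_eq, add_sub_cancel_left, abs_of_pos (by positivity)]
      linarith
  obtain ⟨τ, hτ, N, hN⟩ := hD.exists_good_set hg hε hε2
  set κ := 1 - Λ * ρ with hκ
  have hκ0 : 0 < κ := by linarith
  have hκ1 : κ ≤ 1 := by
    have : 0 ≤ Λ * ρ := mul_nonneg (by positivity) (by positivity)
    linarith
  obtain ⟨N', hN'⟩ := exists_nat_gt ((τ⁻¹) ^ 2)
  refine ⟨Real.exp (14 / κ), max N (max N' 1), fun n hn B hB s hs => ?_⟩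
  simp only [max_le_iff] at hn
  have hnpos : (0 : ℝ) < n := by exact_mod_cast hn.2.2
  have hsq : (√(n : ℝ))⁻¹ * (√(n : ℝ))⁻¹ * n = 1 := by
    rw [← mul_inv, Real.mul_self_sqrt hnpos.le, inv_mul_cancel₀ hnpos.ne']
  have hn1 : (1 : ℝ) ≤ √(n : ℝ) := Real.one_le_sqrt.2 (by exact_mod_cast hn.2.2)
  set t : ℝ := (√(n : ℝ))⁻¹ with ht
  have ht0 : 0 ≤ t := by positivity
  have ht1 : t ≤ 1 := inv_le_one_of_one_le₀ hn1
  have htτ : t ≤ τ := by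
    have h1 : τ⁻¹ ≤ √(n : ℝ) := Real.le_sqrt_of_sq_le
      (hN'.le.trans (by exact_mod_cast hn.2.1))
    exact inv_le_of_inv_le₀ hτ h1
  obtain ⟨Γ, hΓ, hΓδ⟩ := hN n hn.1
  have hpow : (0 : ℝ) < (n : ℝ) ^ 2 := by positivity
  refine ((D n).avg_exp_sum_le (t := t) (A := (2 * (t * n) + 12) / κ) s hs ?_).trans
    (Real.exp_le_exp.2 ?_)
  · intro h h' hh hht hht' hB0
    have main := (D n).sum_avg_ind_sub_le hh (Λ := Λ) (ρ := ρ) (κ := κ)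
      (δ := 3 / (n : ℝ) ^ 2) hε1 (by positivity) hκ0.le hκ1 (by linarith) hΓ
      ((le_div_iff₀ hpow).2 (hΓδ h fun e => (hht e).trans htτ))
      ((le_div_iff₀ hpow).2 (hΓδ h' fun e => (hht' e).trans htτ))
    rw [le_div_iff₀ hκ0, mul_comm]
    refine main.trans (add_le_add ?_ ?_)
    · have hz : ∀ e ∉ B, |h e| + |h' e| = 0 := fun e he => by
        rw [(hB0 e he).1, (hB0 e he).2]; simp
      rw [← Finset.sum_subset (Finset.subset_univ B) fun e _ he => hz e he]
      refine (Finset.sum_le_card_nsmul B _ (2 * t) fun e _ => ?_).trans ?_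
      · linarith [hht e, hht' e]
      · rw [nsmul_eq_mul]
        have : (#B : ℝ) ≤ n := by exact_mod_cast hB
        nlinarith
    · have h1 := hD.card_le n
      have h2 : (Fintype.card (E n) : ℝ) * (3 / (n : ℝ) ^ 2) ≤ (n : ℝ) ^ 2 * (3 / (n : ℝ) ^ 2) :=
        mul_le_mul_of_nonneg_right h1 (by positivity)
      rw [mul_div_cancel₀ _ hpow.ne'] at h2
      linarith
  · rw [← mul_div_assoc]
    refine div_le_div_of_nonneg_right ?_ hκ0.le
    nlinarith

end Laplace

end Energy

section Copies

variable {m n : ℕ}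

lemma exists_perm_comp {A X : Type*} [Finite X] (f g : A ↪ X) :
    ∃ π : Equiv.Perm X, ∀ a, π (f a) = g a := by
  classical
  have := Fintype.ofFinite X
  let e : {x // x ∈ Set.range f} ≃ {x // x ∈ Set.range g} :=
    (Equiv.ofInjective f f.injective).symm.trans (Equiv.ofInjective g g.injective)
  refine ⟨e.extendSubtype, fun a => ?_⟩
  rw [e.extendSubtype_apply_of_mem _ (Set.mem_range_self a)]
  have : (⟨f a, Set.mem_range_self a⟩ : {x // x ∈ Set.range f}) =
      Equiv.ofInjective f f.injective a := rfl
  rw [this]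
  simp [e]

/-- The action of a vertex permutation on edges. -/
def permEdge (π : Equiv.Perm (Fin n)) : EdgeSet n ≃ EdgeSet n where
  toFun e := ⟨Sym2.map π e.1, by rw [Sym2.isDiag_map π.injective]; exact e.2⟩
  invFun e := ⟨Sym2.map π.symm e.1, by rw [Sym2.isDiag_map π.symm.injective]; exact e.2⟩
  left_inv e := Subtype.ext (by simp [Sym2.map_map])
  right_inv e := Subtype.ext (by simp [Sym2.map_map])

/-- The edge joining two distinct vertices. -/
def mkEdge {a b : Fin n} (h : a ≠ b) : EdgeSet n := ⟨s(a, b), by simpa using h⟩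

lemma exists_eq_mkEdge (e : EdgeSet n) : ∃ (a b : Fin n) (h : a ≠ b), e = mkEdge h := by
  obtain ⟨p, hp⟩ := e
  induction p using Sym2.ind with
  | _ a b => exact ⟨a, b, by simpa using hp, rfl⟩

lemma permEdge_mkEdge (π : Equiv.Perm (Fin n)) {a b : Fin n} (h : a ≠ b) :
    permEdge π (mkEdge h) = mkEdge (π.injective.ne h) := rfl

lemma exists_permEdge_eq (e f : EdgeSet n) : ∃ π, permEdge π e = f := by
  obtain ⟨a, b, hab, rfl⟩ := exists_eq_mkEdge e
  obtain ⟨c, d, hcd, rfl⟩ := exists_eq_mkEdge f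
  have hinj : ∀ {a b : Fin n}, a ≠ b → Function.Injective (fun t : Bool => if t then a else b) := by
    intro a b h s t hst
    cases s <;> cases t <;> simp_all
  obtain ⟨π, hπ⟩ := exists_perm_comp ⟨_, hinj hab⟩ ⟨_, hinj hcd⟩
  have h1 := hπ true
  have h2 := hπ false
  simp only [Function.Embedding.coeFn_mk, if_true, Bool.false_eq_true, if_false] at h1 h2
  exact ⟨π, Subtype.ext (by simp [permEdge, mkEdge, h1, h2])⟩

open scoped Classical in
/-- The edges of the copy of `G` given by `ψ`. -/
noncomputable def copyEdges (G : SimpleGraph (Fin m)) (ψ : Fin m ↪ Fin n) : Finset (EdgeSet n) :=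
  Finset.univ.filter fun e => ∃ a b, G.Adj a b ∧ e.1 = s(ψ a, ψ b)

lemma mem_copyEdges {G : SimpleGraph (Fin m)} {ψ : Fin m ↪ Fin n} {e : EdgeSet n} :
    e ∈ copyEdges G ψ ↔ ∃ a b, G.Adj a b ∧ e.1 = s(ψ a, ψ b) := by
  simp [copyEdges]

lemma permEdge_mem_copyEdges {G : SimpleGraph (Fin m)} {ψ : Fin m ↪ Fin n} {e : EdgeSet n}
    (π : Equiv.Perm (Fin n)) :
    permEdge π e ∈ copyEdges G (ψ.trans π.toEmbedding) ↔ e ∈ copyEdges G ψ := by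
  have h : ∀ a b : Fin m, s(π (ψ a), π (ψ b)) = Sym2.map π s(ψ a, ψ b) := fun a b => rfl
  simp only [mem_copyEdges, permEdge, Equiv.coe_fn_mk, Function.Embedding.trans_apply,
    Equiv.coe_toEmbedding, h, (Sym2.map.injective π.injective).eq_iff]

lemma card_copyEdges (G : SimpleGraph (Fin m)) (ψ : Fin m ↪ Fin n) :
    #(copyEdges G ψ) = numEdges G := by
  have h : Subtype.val '' (copyEdges G ψ : Set (EdgeSet n)) = Sym2.map ψ '' G.edgeSet := by
    ext p
    constructor
    · rintro ⟨e, he, rfl⟩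
      obtain ⟨a, b, hab, h⟩ := mem_copyEdges.1 he
      exact ⟨s(a, b), hab, h.symm⟩
    · rintro ⟨p, hp, rfl⟩
      induction p using Sym2.ind with
      | _ a b =>
        have hab : G.Adj a b := hp
        exact ⟨mkEdge (ψ.injective.ne hab.ne), mem_copyEdges.2 ⟨a, b, hab, rfl⟩, rfl⟩
  rw [numEdges, ← Set.ncard_image_of_injective _ (Sym2.map.injective ψ.injective), ← h,
    Set.ncard_image_of_injective _ Subtype.val_injective, Set.ncard_coe_finset]

lemma prod_edgeInd_eq_mon (G : SimpleGraph (Fin m)) (ψ : Fin m ↪ Fin n) (x : Config n) :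
    (∏ a : Fin m, ∏ b : Fin m,
      @ite _ (G.Adj a b) (Classical.propDecidable _) (edgeInd x (ψ a) (ψ b)) 1) =
      mon (copyEdges G ψ) x := by
  classical
  have hval : ∀ {a b} (h : G.Adj a b),
      edgeVal x (ψ a) (ψ b) = x (mkEdge (ψ.injective.ne h.ne)) := by
    intro a b h
    have : ¬ (s(ψ a, ψ b) : Sym2 (Fin n)).IsDiag := by simpa using h.ne
    rw [edgeVal, dif_neg this]
    rfl
  rw [mon_eq_ite]
  split_ifs with hall
  · refine Finset.prod_eq_one fun a _ => Finset.prod_eq_one fun b _ => ?_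
    split_ifs with hab
    · rw [edgeInd, hval hab, if_pos]
      exact hall _ (mem_copyEdges.2 ⟨a, b, hab, rfl⟩)
    · rfl
  · push Not at hall
    obtain ⟨e, he, hx⟩ := hall
    obtain ⟨a, b, hab, h⟩ := mem_copyEdges.1 he
    refine Finset.prod_eq_zero (Finset.mem_univ a) (Finset.prod_eq_zero (Finset.mem_univ b) ?_)
    have : e = mkEdge (ψ.injective.ne hab.ne) := Subtype.ext h
    rw [if_pos hab, edgeInd, hval hab, ← this, if_neg (by simpa using hx)]

open scoped Classical in
/-- The number of copies of `G` in the complete graph that use the edge `e`. -/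
noncomputable def copyCount (G : SimpleGraph (Fin m)) (e : EdgeSet n) : ℕ :=
  #((Finset.univ : Finset (Fin m ↪ Fin n)).filter fun ψ => e ∈ copyEdges G ψ)

/-- Composition with a permutation, as an equivalence of embeddings. -/
def embPerm (m : ℕ) (π : Equiv.Perm (Fin n)) : (Fin m ↪ Fin n) ≃ (Fin m ↪ Fin n) where
  toFun ψ := ψ.trans π.toEmbedding
  invFun ψ := ψ.trans π.symm.toEmbedding
  left_inv ψ := by ext; simp
  right_inv ψ := by ext; simp

lemma copyCount_permEdge (G : SimpleGraph (Fin m)) (π : Equiv.Perm (Fin n)) (e : EdgeSet n) :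
    copyCount G (permEdge π e) = copyCount G e := by
  classical
  unfold copyCount
  symm
  refine Finset.card_equiv (embPerm m π) fun ψ => ?_
  simp only [Finset.mem_filter, Finset.mem_univ, true_and, embPerm, Equiv.coe_fn_mk,
    permEdge_mem_copyEdges]

lemma card_edgeSet (n : ℕ) : Fintype.card (EdgeSet n) = n.choose 2 := by
  rw [Sym2.card_subtype_not_diag, Fintype.card_fin]

lemma choose_mul_copyCount (G : SimpleGraph (Fin m)) (e : EdgeSet n) :
    n.choose 2 * copyCount G e = numEdges G * n.descFactorial m := by
  classical
  have h1 : ∑ f : EdgeSet n, copyCount G f = n.choose 2 * copyCount G e := by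
    rw [Finset.sum_congr rfl fun f _ => ?_, Finset.sum_const, Finset.card_univ, card_edgeSet,
      smul_eq_mul]
    obtain ⟨π, rfl⟩ := exists_permEdge_eq e f
    exact copyCount_permEdge G π e
  rw [← h1]
  unfold copyCount
  refine (Finset.sum_card_bipartiteAbove_eq_sum_card_bipartiteBelow
    (s := (Finset.univ : Finset (EdgeSet n))) (t := (Finset.univ : Finset (Fin m ↪ Fin n)))
    (fun f ψ => f ∈ copyEdges G ψ)).trans ?_
  simp only [Finset.bipartiteBelow, Finset.filter_mem_eq_inter, Finset.univ_inter,
    card_copyEdges, Finset.sum_const, Finset.card_univ, Fintype.card_embedding_eq,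
    Fintype.card_fin, smul_eq_mul]
  exact mul_comm _ _

open scoped Classical in
lemma card_embedding_comp_le {k : ℕ} (τ : Fin k ↪ Fin m) (v : Fin k ↪ Fin n) :
    #((Finset.univ : Finset (Fin m ↪ Fin n)).filter fun ψ => ∀ t, ψ (τ t) = v t) ≤
      n ^ (m - k) := by
  rw [← Fintype.card_subtype]
  have hcard : Fintype.card ({i : Fin m // i ∉ Set.range τ} → Fin n) = n ^ (m - k) := by
    rw [Fintype.card_fun, Fintype.card_fin, Fintype.card_subtype_compl]
    congr 1
    rw [Fintype.card_fin]
    congr 1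
    exact (Fintype.card_congr (Equiv.ofInjective τ τ.injective)).symm.trans (Fintype.card_fin k)
  rw [← hcard]
  refine Fintype.card_le_of_injective (fun ψ i => ψ.1 i.1) fun ψ φ h => ?_
  ext i
  by_cases hi : i ∈ Set.range τ
  · obtain ⟨t, rfl⟩ := hi
    rw [ψ.2 t, φ.2 t]
  · exact congrArg Fin.val (congrFun h ⟨i, hi⟩)

lemma exists_three_vertices {e f : EdgeSet n} (hef : e ≠ f) :
    ∃ v : Fin 3 ↪ Fin n, ∀ t, v t ∈ e.1 ∨ v t ∈ f.1 := by
  obtain ⟨a, b, hab, rfl⟩ := exists_eq_mkEdge e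
  obtain ⟨c, d, hcd, rfl⟩ := exists_eq_mkEdge f
  have key : ∀ w : Fin n, w ≠ a → w ≠ b → (w = c ∨ w = d) →
      ∃ v : Fin 3 ↪ Fin n, ∀ t, v t ∈ (mkEdge hab).1 ∨ v t ∈ (mkEdge hcd).1 := by
    intro w h1 h2 h3
    refine ⟨⟨![a, b, w], ?_⟩, ?_⟩
    · intro i j hij
      fin_cases i <;> fin_cases j <;> simp_all [eq_comm]
    · intro t
      fin_cases t
      · exact Or.inl (Sym2.mem_mk_left _ _)
      · exact Or.inl (Sym2.mem_mk_right _ _)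
      · exact Or.inr (Sym2.mem_iff.2 h3)
  by_cases hc : c ≠ a ∧ c ≠ b
  · exact key c hc.1 hc.2 (Or.inl rfl)
  by_cases hd : d ≠ a ∧ d ≠ b
  · exact key d hd.1 hd.2 (Or.inr rfl)
  · exfalso
    apply hef
    apply Subtype.ext
    simp only [mkEdge, Sym2.eq_iff]
    simp only [not_and_or, not_not] at hc hd
    rcases hc with rfl | rfl <;> rcases hd with rfl | rfl <;>
      first | exact absurd rfl hcd | simp

open scoped Classical in
lemma card_copies_two_edges_le (G : SimpleGraph (Fin m)) {e f : EdgeSet n} (hef : e ≠ f) :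
    (#((Finset.univ : Finset (Fin m ↪ Fin n)).filter
      fun ψ => e ∈ copyEdges G ψ ∧ f ∈ copyEdges G ψ) : ℝ) / (n : ℝ) ^ (m - 2) ≤
      (m : ℝ) ^ 3 / n := by
  obtain ⟨v, hv⟩ := exists_three_vertices hef
  have hn : 0 < n := (Fin.pos (v 0))
  have hn' : (0 : ℝ) < n := by exact_mod_cast hn
  have hsub : ((Finset.univ : Finset (Fin m ↪ Fin n)).filter
      fun ψ => e ∈ copyEdges G ψ ∧ f ∈ copyEdges G ψ) ⊆
      (Finset.univ : Finset (Fin 3 ↪ Fin m)).biUnion fun τ =>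
        (Finset.univ : Finset (Fin m ↪ Fin n)).filter fun ψ => ∀ t, ψ (τ t) = v t := by
    intro ψ hψ
    simp only [Finset.mem_filter, Finset.mem_univ, true_and] at hψ
    have hmem : ∀ g : EdgeSet n, g ∈ copyEdges G ψ → ∀ w ∈ g.1, ∃ i, ψ i = w := by
      intro g hg w hw
      obtain ⟨a, b, -, h⟩ := mem_copyEdges.1 hg
      rw [h, Sym2.mem_iff] at hw
      rcases hw with rfl | rfl
      exacts [⟨a, rfl⟩, ⟨b, rfl⟩]
    have hex : ∀ t, ∃ i, ψ i = v t := fun t =>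
      (hv t).elim (hmem e hψ.1 _) (hmem f hψ.2 _)
    choose τ hτ using hex
    have hinj : Function.Injective τ := fun s t hst => v.injective (by rw [← hτ, ← hτ, hst])
    simp only [Finset.mem_biUnion, Finset.mem_univ, true_and, Finset.mem_filter]
    exact ⟨⟨τ, hinj⟩, hτ⟩
  have hle := (Finset.card_le_card hsub).trans
    (Finset.card_biUnion_le_card_mul _ _ _ fun τ _ => card_embedding_comp_le τ v)
  rw [Finset.card_univ, Fintype.card_embedding_eq, Fintype.card_fin, Fintype.card_fin] at hle
  rw [div_le_div_iff₀ (by positivity) hn']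
  have hm3 : (m.descFactorial 3 * n ^ (m - 3)) * n ≤ m ^ 3 * n ^ (m - 2) := by
    rcases lt_or_ge m 3 with hm | hm
    · rw [Nat.descFactorial_of_lt hm]
      simp
    · rw [mul_assoc, ← pow_succ, show m - 3 + 1 = m - 2 by omega]
      exact Nat.mul_le_mul_right _ (Nat.descFactorial_le_pow m 3)
  exact_mod_cast (Nat.mul_le_mul_right n hle).trans hm3

end Copies

section CopyRatio

variable {m : ℕ}

/-- The normalised number of copies of `G` through a given edge of `K_n`. -/
noncomputable def copyRatio (G : SimpleGraph (Fin m)) (n : ℕ) : ℝ :=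
  numEdges G * n.descFactorial m / (n.choose 2 * (n : ℝ) ^ (m - 2))

lemma copyRatio_nonneg (G : SimpleGraph (Fin m)) (n : ℕ) : 0 ≤ copyRatio G n := by
  unfold copyRatio
  positivity

lemma copyCount_div_eq (G : SimpleGraph (Fin m)) {n : ℕ} (e : EdgeSet n) :
    (copyCount G e : ℝ) / (n : ℝ) ^ (m - 2) = copyRatio G n := by
  have h : (n.choose 2 : ℝ) ≠ 0 := by
    rw [← card_edgeSet]
    exact_mod_cast (Fintype.card_pos_iff.2 ⟨e⟩).ne'
  have h2 : (n.choose 2 : ℝ) * copyCount G e = numEdges G * n.descFactorial m := by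
    exact_mod_cast choose_mul_copyCount G e
  rw [copyRatio, ← h2, mul_div_mul_left _ _ h]

lemma two_le_of_numEdges_ne_zero {G : SimpleGraph (Fin m)} (h : numEdges G ≠ 0) : 2 ≤ m := by
  obtain ⟨p, hp⟩ := Set.nonempty_of_ncard_ne_zero h
  induction p using Sym2.ind with
  | _ a b =>
    have hab : a ≠ b := SimpleGraph.Adj.ne (G := G) hp
    have := Fin.val_ne_of_ne hab
    omega

lemma tendsto_descFactorial_div_pow (k : ℕ) :
    Tendsto (fun n : ℕ => (n.descFactorial k : ℝ) / (n : ℝ) ^ k) atTop (nhds 1) := by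
  refine (Asymptotics.isEquivalent_iff_tendsto_one ?_).1 (isEquivalent_descFactorial k)
  filter_upwards [eventually_gt_atTop 0] with n hn
  have : (0 : ℝ) < n := by exact_mod_cast hn
  positivity

lemma tendsto_copyRatio (G : SimpleGraph (Fin m)) :
    Tendsto (copyRatio G) atTop (nhds (2 * numEdges G)) := by
  by_cases h : numEdges G = 0
  · have : copyRatio G = fun _ => 0 := by
      funext n
      simp [copyRatio, h]
    rw [this, h]
    simp
  have hm := two_le_of_numEdges_ne_zero h
  have h2 := ((tendsto_descFactorial_div_pow m).div (tendsto_descFactorial_div_pow 2)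
    one_ne_zero).const_mul (2 * (numEdges G : ℝ))
  rw [div_one, mul_one] at h2
  refine h2.congr' ?_
  filter_upwards [eventually_ge_atTop 2] with n hn
  have hn0 : (0 : ℝ) < n := by exact_mod_cast (by omega : 0 < n)
  have hc : (0 : ℝ) < n.choose 2 := by exact_mod_cast Nat.choose_pos hn
  have e1 : (n.descFactorial 2 : ℝ) = 2 * n.choose 2 := by
    exact_mod_cast Nat.descFactorial_eq_factorial_mul_choose n 2
  have e2 : (n : ℝ) ^ m = (n : ℝ) ^ (m - 2) * (n : ℝ) ^ 2 := by
    rw [← pow_add]; congr 1; omega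
  simp only [Pi.div_apply, copyRatio]
  rw [e1, e2]
  field_simp

lemma exists_copyRatio_le (G : SimpleGraph (Fin m)) : ∃ K : ℝ, ∀ n, copyRatio G n ≤ K := by
  obtain ⟨K, hK⟩ := (tendsto_copyRatio G).bddAbove_range
  exact ⟨K, fun n => hK ⟨n, rfl⟩⟩

end CopyRatio

section ErgmEnergy

variable {s : ℕ} (V : Fin s → ℕ) (G : ∀ i, SimpleGraph (Fin (V i))) (β : Fin s → ℝ)
  (hβ : ∀ i, 0 < β i)

/-- The Hamiltonian of the exponential random graph as a polynomial energy. -/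
noncomputable def ergmEnergy (n : ℕ) : Energy (EdgeSet n) (Σ i : Fin s, (Fin (V i) ↪ Fin n)) where
  coeff k := β k.1 / (n : ℝ) ^ (V k.1 - 2)
  supp k := copyEdges (G k.1) k.2
  coeff_nonneg k := div_nonneg (hβ k.1).le (by positivity)

variable {n : ℕ}

lemma ham_ergmEnergy (x : Config n) : (ergmEnergy V G β hβ n).ham x = Hamiltonian V G β x := by
  unfold Energy.ham Hamiltonian NG
  rw [Fintype.sum_sigma]
  refine Finset.sum_congr rfl fun i _ => ?_
  rw [Finset.mul_sum, Finset.sum_div]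
  refine Finset.sum_congr rfl fun ψ _ => ?_
  rw [prod_edgeInd_eq_mon]
  simp only [ergmEnergy]
  ring

lemma weight_ergmEnergy (x : Config n) :
    (ergmEnergy V G β hβ n).weight 0 x = Real.exp (Hamiltonian V G β x) := by
  unfold Energy.weight
  rw [ham_ergmEnergy]
  simp

lemma ergmProb_eq (x : Config n) : ergmProb V G β x = (ergmEnergy V G β hβ n).weight 0 x /
    ∑ y, (ergmEnergy V G β hβ n).weight 0 y := by
  simp only [ergmProb, weight_ergmEnergy]

lemma expect_ergmProb (F : Config n → ℝ) :
    expect (ergmProb V G β) F = avg ((ergmEnergy V G β hβ n).weight 0) F := by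
  unfold expect avg
  rw [Finset.sum_div]
  refine Finset.sum_congr rfl fun x _ => ?_
  rw [ergmProb_eq V G β hβ]
  ring

/-- Averages under the random graph are invariant under relabelling of the vertices. -/
lemma avg_comp_permEdge (π : Equiv.Perm (Fin n)) (F : Config n → ℝ) :
    avg ((ergmEnergy V G β hβ n).weight 0) (fun x => F fun e => x (permEdge π e)) =
      avg ((ergmEnergy V G β hβ n).weight 0) F := by
  have hmon : ∀ {m : ℕ} (H : SimpleGraph (Fin m)) (ψ : Fin m ↪ Fin n) (x : Config n),
      mon (copyEdges H ψ) (fun e => x (permEdge π e)) =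
        mon (copyEdges H (ψ.trans π.toEmbedding)) x := by
    intro m H ψ x
    unfold mon
    exact Finset.prod_equiv (permEdge π) (fun e => (permEdge_mem_copyEdges π).symm) fun e _ => rfl
  have hham : ∀ x : Config n, (ergmEnergy V G β hβ n).ham (fun e => x (permEdge π e)) =
      (ergmEnergy V G β hβ n).ham x := by
    intro x
    unfold Energy.ham
    rw [Fintype.sum_sigma, Fintype.sum_sigma]
    refine Finset.sum_congr rfl fun i _ => ?_
    simp only [ergmEnergy, hmon]
    exact Equiv.sum_comp (embPerm (V i) π)
      fun ψ => β i / (n : ℝ) ^ (V i - 2) * mon (copyEdges (G i) ψ) x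
  have hw : ∀ x : Config n, (ergmEnergy V G β hβ n).weight 0 (fun e => x (permEdge π e)) =
      (ergmEnergy V G β hβ n).weight 0 x := by
    intro x
    simp only [weight_ergmEnergy, ← ham_ergmEnergy V G β hβ, hham]
  unfold avg
  congr 1
  rw [← Equiv.sum_comp ((permEdge π).arrowCongr (Equiv.refl Bool)).symm
    fun x => (ergmEnergy V G β hβ n).weight 0 x * F x]
  refine Finset.sum_congr rfl fun x _ => ?_
  rw [← hw x]
  rfl

lemma sum_copies (c : Fin s → ℝ) (e : EdgeSet n) :
    ∑ k, (if e ∈ (ergmEnergy V G β hβ n).supp k then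
      (ergmEnergy V G β hβ n).coeff k * c k.1 else 0) =
      ∑ i, β i * copyRatio (G i) n * c i := by
  rw [Fintype.sum_sigma]
  refine Finset.sum_congr rfl fun i _ => ?_
  change ∑ ψ : Fin (V i) ↪ Fin n, (if e ∈ copyEdges (G i) ψ then
    β i / (n : ℝ) ^ (V i - 2) * c i else 0) = _
  rw [← Finset.sum_filter, Finset.sum_const, nsmul_eq_mul, ← copyCount_div_eq (G i) e]
  have : copyCount (G i) e =
      #((Finset.univ : Finset (Fin (V i) ↪ Fin n)).filter fun ψ => e ∈ copyEdges (G i) ψ) := by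
    unfold copyCount
    congr!
  rw [this]
  ring

lemma degree_ergmEnergy (e : EdgeSet n) :
    (ergmEnergy V G β hβ n).degree e = ∑ i, β i * copyRatio (G i) n := by
  have := sum_copies V G β hβ (fun _ => 1) e
  simpa [Energy.degree] using this

lemma meanSlope_ergmEnergy (q : ℝ) (e : EdgeSet n) :
    (ergmEnergy V G β hβ n).meanSlope q e =
      ∑ i, β i * copyRatio (G i) n * q ^ (numEdges (G i) - 1) := by
  rw [← sum_copies V G β hβ (fun i => q ^ (numEdges (G i) - 1)) e]
  unfold Energy.meanSlope
  refine Finset.sum_congr rfl fun k _ => ?_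
  have : #((ergmEnergy V G β hβ n).supp k) = numEdges (G k.1) := card_copyEdges _ _
  rw [this]

lemma meanRow_ergmEnergy (q : ℝ) (e : EdgeSet n) :
    (ergmEnergy V G β hβ n).meanRow q e = ∑ i, β i * copyRatio (G i) n *
      ((numEdges (G i) - 1 : ℕ) * q ^ (numEdges (G i) - 2)) := by
  rw [← sum_copies V G β hβ
    (fun i => ((numEdges (G i) - 1 : ℕ) * q ^ (numEdges (G i) - 2))) e]
  unfold Energy.meanRow
  refine Finset.sum_congr rfl fun k _ => ?_
  have : #((ergmEnergy V G β hβ n).supp k) = numEdges (G k.1) := card_copyEdges _ _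
  rw [this]

lemma codegree_ergmEnergy_le {e f : EdgeSet n} (hef : e ≠ f) :
    (ergmEnergy V G β hβ n).codegree e f ≤ (∑ i, β i * (V i : ℝ) ^ 3) / n := by
  unfold Energy.codegree
  rw [Fintype.sum_sigma, Finset.sum_div]
  refine Finset.sum_le_sum fun i _ => ?_
  change ∑ ψ : Fin (V i) ↪ Fin n, (if e ∈ copyEdges (G i) ψ ∧ f ∈ copyEdges (G i) ψ then
    β i / (n : ℝ) ^ (V i - 2) else 0) ≤ _
  rw [← Finset.sum_filter, Finset.sum_const, nsmul_eq_mul, mul_div_assoc, mul_div_left_comm]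
  refine mul_le_mul_of_nonneg_left ?_ (hβ i).le
  convert card_copies_two_edges_le (G i) hef using 5

/-- The limiting row sum of the random graph, the derivative of `Psi`. -/
noncomputable def PsiDeriv (q : ℝ) : ℝ :=
  ∑ i, 2 * β i * (numEdges (G i) : ℝ) *
    ((numEdges (G i) - 1 : ℕ) * q ^ (numEdges (G i) - 2))

lemma hasDerivAt_Psi (q : ℝ) : HasDerivAt (Psi V G β) (PsiDeriv V G β q) q := by
  unfold Psi PsiDeriv
  refine HasDerivAt.fun_sum fun i _ => ?_
  refine (hasDerivAt_pow (numEdges (G i) - 1) q).const_mul _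

lemma continuous_Psi : Continuous (Psi V G β) := by
  unfold Psi
  fun_prop

lemma continuous_PsiDeriv : Continuous (PsiDeriv V G β) := by
  unfold PsiDeriv
  fun_prop

/-- Uniform convergence of polynomials whose coefficients are copy ratios. -/
lemma exists_abs_sum_copyRatio_le (c : Fin s → ℝ → ℝ) {M : ℝ}
    (hc : ∀ i, ∀ q ∈ Set.Icc (0 : ℝ) 1, |c i q| ≤ M) {ε : ℝ} (hε : 0 < ε) :
    ∃ N : ℕ, ∀ n, N ≤ n → ∀ q ∈ Set.Icc (0 : ℝ) 1,
      |∑ i, β i * copyRatio (G i) n * c i q -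
        ∑ i, 2 * β i * (numEdges (G i) : ℝ) * c i q| ≤ ε := by
  have hlim : Tendsto (fun n => ∑ i, |β i| * |copyRatio (G i) n - 2 * numEdges (G i)| * M) atTop
      (nhds 0) := by
    have h : ∀ i, Tendsto (fun n => |β i| * |copyRatio (G i) n - 2 * numEdges (G i)| * M) atTop
        (nhds 0) := by
      intro i
      have := ((((tendsto_copyRatio (G i)).sub_const (2 * (numEdges (G i) : ℝ))).abs).const_mul
        |β i|).mul_const M
      simpa using this
    simpa using tendsto_finsetSum Finset.univ fun i _ => h i
  obtain ⟨N, hN⟩ := eventually_atTop.1 (hlim.eventually_lt_const hε)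
  refine ⟨N, fun n hn q hq => le_trans ?_ (hN n hn).le⟩
  rw [← Finset.sum_sub_distrib]
  refine (Finset.abs_sum_le_sum_abs _ _).trans (Finset.sum_le_sum fun i _ => ?_)
  have : β i * copyRatio (G i) n * c i q - 2 * β i * numEdges (G i) * c i q =
      β i * (copyRatio (G i) n - 2 * numEdges (G i)) * c i q := by ring
  rw [this, abs_mul, abs_mul]
  exact mul_le_mul_of_nonneg_left (hc i q hq) (by positivity)

lemma meanField_ergmEnergy : ∃ (d : ℕ) (K : ℝ),
    Energy.MeanField (ergmEnergy V G β hβ) d K (Psi V G β) (PsiDeriv V G β) := by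
  choose K hK using fun i => exists_copyRatio_le (G i)
  have hK0 : ∀ i, 0 ≤ K i := fun i => (copyRatio_nonneg (G i) 0).trans (hK i 0)
  set d := ∑ i, numEdges (G i) with hd
  have hdi : ∀ i, numEdges (G i) ≤ d := fun i =>
    (Finset.single_le_sum (f := fun i => numEdges (G i)) (fun _ _ => Nat.zero_le _)
      (Finset.mem_univ i))
  have hs1 : 0 ≤ ∑ i, β i * K i := Finset.sum_nonneg fun i _ => mul_nonneg (hβ i).le (hK0 i)
  have hs2 : 0 ≤ ∑ i, β i * (V i : ℝ) ^ 3 :=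
    Finset.sum_nonneg fun i _ => mul_nonneg (hβ i).le (by positivity)
  have hpow : ∀ (k : ℕ) (q : ℝ), q ∈ Set.Icc (0 : ℝ) 1 → |q ^ k| ≤ 1 := fun k q hq => by
    rw [abs_of_nonneg (pow_nonneg hq.1 k)]
    exact pow_le_one₀ hq.1 hq.2
  refine ⟨d, ∑ i, β i * K i + ∑ i, β i * (V i : ℝ) ^ 3, add_nonneg hs1 hs2, fun n hn => ?_,
    fun n => ?_, continuous_Psi V G β, continuous_PsiDeriv V G β, fun ε hε => ?_, fun ε hε => ?_⟩
  · refine ⟨fun k => (card_copyEdges _ _).le.trans (hdi k.1), fun e => ?_,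
      fun e f hef => ?_⟩
    · rw [degree_ergmEnergy]
      have : ∑ i, β i * copyRatio (G i) n ≤ ∑ i, β i * K i :=
        Finset.sum_le_sum fun i _ => mul_le_mul_of_nonneg_left (hK i n) (hβ i).le
      linarith
    · refine (codegree_ergmEnergy_le V G β hβ hef).trans ?_
      exact div_le_div_of_nonneg_right (by linarith) (Nat.cast_nonneg n)
  · rw [card_edgeSet]
    exact_mod_cast Nat.choose_le_pow n 2
  · obtain ⟨N, hN⟩ := exists_abs_sum_copyRatio_le V G β
      (fun i q => q ^ (numEdges (G i) - 1)) (M := 1) (fun i q hq => hpow _ q hq) hε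
    refine ⟨N, fun n hn q hq e => ?_⟩
    rw [meanSlope_ergmEnergy]
    exact hN n hn q hq
  · have hc : ∀ i, ∀ q ∈ Set.Icc (0 : ℝ) 1,
        |((numEdges (G i) - 1 : ℕ) : ℝ) * q ^ (numEdges (G i) - 2)| ≤ d := fun i q hq => by
      rw [abs_mul, Nat.abs_cast]
      refine (mul_le_of_le_one_right (Nat.cast_nonneg _) (hpow _ q hq)).trans ?_
      exact_mod_cast (Nat.sub_le _ _).trans (hdi i)
    obtain ⟨N, hN⟩ := exists_abs_sum_copyRatio_le V G β
      (fun i q => (numEdges (G i) - 1 : ℕ) * q ^ (numEdges (G i) - 2)) hc hε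
    refine ⟨N, fun n hn q hq e => ?_⟩
    rw [meanRow_ergmEnergy]
    exact hN n hn q hq

/-- In the subcritical regime, centred edge counts over at most `n` edges have bounded
exponential moments at scale `n^{-1/2}`. -/
lemma Subcritical.avg_exp_sum_le {p : ℝ} (hsub : Subcritical V G β p) :
    ∃ C : ℝ, ∃ N : ℕ, ∀ n, N ≤ n → ∀ B : Finset (EdgeSet n), #B ≤ n →
      ∀ t : ℝ, |t| = (√(n : ℝ))⁻¹ →
        avg ((ergmEnergy V G β hβ n).weight 0) (fun x => Real.exp (t * ∑ e ∈ B,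
          (ind (x e) - avg ((ergmEnergy V G β hβ n).weight 0) fun x => ind (x e)))) ≤ C := by
  obtain ⟨d, K, hD⟩ := meanField_ergmEnergy V G β hβ
  obtain ⟨hfix, huniq, hderiv⟩ := hsub
  have hfix' : Phi (Psi V G β p) = p := hfix
  have hcoef : ∀ i, 0 ≤ 2 * β i * (numEdges (G i) : ℝ) := fun i => by
    have := (hβ i).le
    positivity
  have hu : ∀ z, Psi V G β (Phi z) = z → z = Psi V G β p := by
    intro z hz
    have : Phi z = p := huniq _ (by unfold phiFn; rw [hz])
    rw [← hz, this]
  have hψK : ∀ q ∈ Set.Icc (0 : ℝ) 1,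
      Psi V G β q ∈ Set.Icc 0 (∑ i, 2 * β i * (numEdges (G i) : ℝ)) := by
    intro q hq
    refine ⟨Finset.sum_nonneg fun i _ => mul_nonneg (hcoef i) (pow_nonneg hq.1 _),
      Finset.sum_le_sum fun i _ => mul_le_of_le_one_right (hcoef i) (pow_le_one₀ hq.1 hq.2)⟩
  refine hD.avg_exp_sum_le (a := Psi V G β p)
    (fun σ hσ => Energy.signed_gap_of_unique (continuous_Psi V G β) hσ hψK hu) ?_ ?_
  · rw [hfix']
    have hp : 0 ≤ p := hfix' ▸ (Phi_pos _).le
    exact Finset.sum_nonneg fun i _ => mul_nonneg (hcoef i)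
      (mul_nonneg (Nat.cast_nonneg _) (pow_nonneg hp _))
  · have h1 : HasDerivAt (phiFn V G β)
        (Phi (Psi V G β p) * (1 - Phi (Psi V G β p)) * PsiDeriv V G β p) p :=
      (hasDerivAt_Phi _).comp p (hasDerivAt_Psi V G β p)
    rw [h1.deriv] at hderiv
    nth_rewrite 3 [hfix']
    exact hderiv

end ErgmEnergy

section BlockEdges

variable {κ : Type*} {n : ℕ}

/-- The edge with endpoints `φ (r, false)` and `φ (r, true)`. -/
def blockEdge (φ : κ × Bool ↪ Fin n) (r : κ) : EdgeSet n :=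
  mkEdge (a := φ (r, false)) (b := φ (r, true)) (φ.injective.ne (by simp))

lemma exists_blockEdge_eq {i : κ → EdgeSet n} (hi : ∀ r r', r ≠ r' → ¬ ShareVertex (i r) (i r')) :
    ∃ φ : κ × Bool ↪ Fin n, ∀ r, i r = blockEdge φ r := by
  choose a b h hab using fun r => exists_eq_mkEdge (i r)
  have hmem : ∀ r (t : Bool), (if t then b r else a r) ∈ (i r).1 := by
    intro r t
    rw [hab r]
    cases t <;> simp [mkEdge]
  refine ⟨⟨fun q => if q.2 then b q.1 else a q.1, ?_⟩, fun r => ?_⟩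
  · rintro ⟨r, t⟩ ⟨r', t'⟩ heq
    have hr : r = r' := by
      by_contra hne
      refine hi r r' hne ⟨_, hmem r t, ?_⟩
      have := hmem r' t'
      dsimp only at heq
      rwa [← heq] at this
    subst hr
    have hr := h r
    cases t <;> cases t' <;> simp_all [eq_comm]
  · rw [hab r]
    rfl

lemma blockEdge_injective (φ : κ × Bool ↪ Fin n) : Function.Injective (blockEdge φ) := by
  intro r r' h
  have h1 : φ (r, false) ∈ (blockEdge φ r').1 := by
    rw [← h]
    exact Sym2.mem_mk_left _ _
  rcases Sym2.mem_iff.1 h1 with h2 | h2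
  · simpa using φ.injective h2
  · simpa using φ.injective h2

lemma exists_permEdge_blockEdge (φ φ' : κ × Bool ↪ Fin n) :
    ∃ π : Equiv.Perm (Fin n), ∀ r, permEdge π (blockEdge φ r) = blockEdge φ' r := by
  obtain ⟨π, hπ⟩ := exists_perm_comp φ φ'
  refine ⟨π, fun r => ?_⟩
  unfold blockEdge
  rw [permEdge_mkEdge]
  congr 1 <;> exact hπ _

end BlockEdges

section Moments

variable {s : ℕ} (V : Fin s → ℕ) (G : ∀ i, SimpleGraph (Fin (V i))) (β : Fin s → ℝ)
  (hβ : ∀ i, 0 < β i)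

/-- The edge variable at `e`, centred at its mean. -/
noncomputable def centred {n : ℕ} (e : EdgeSet n) (x : Config n) : ℝ :=
  ind (x e) - avg ((ergmEnergy V G β hβ n).weight 0) fun x => ind (x e)

variable {n : ℕ}

lemma mean_mem_Icc (e : EdgeSet n) :
    avg ((ergmEnergy V G β hβ n).weight 0) (fun x => ind (x e)) ∈ Set.Icc (0 : ℝ) 1 := by
  refine ⟨avg_nonneg (Energy.weight_pos _ _) fun x => ind_nonneg _, ?_⟩
  refine (avg_mono (Energy.weight_pos _ _) fun x => ind_le_one (x e)).trans ?_
  rw [avg_const (Energy.weight_pos _ _)]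

lemma mean_permEdge (π : Equiv.Perm (Fin n)) (e : EdgeSet n) :
    (avg ((ergmEnergy V G β hβ n).weight 0) fun x => ind (x (permEdge π e))) =
      avg ((ergmEnergy V G β hβ n).weight 0) fun x => ind (x e) :=
  avg_comp_permEdge V G β hβ π fun x => ind (x e)

lemma avg_prod_centred_blockEdge {κ : Type*} [Fintype κ] (φ φ' : κ × Bool ↪ Fin n) :
    (avg ((ergmEnergy V G β hβ n).weight 0) fun x =>
      ∏ r, centred V G β hβ (blockEdge φ' r) x) =
      avg ((ergmEnergy V G β hβ n).weight 0) fun x =>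
        ∏ r, centred V G β hβ (blockEdge φ r) x := by
  obtain ⟨π, hπ⟩ := exists_permEdge_blockEdge φ φ'
  rw [← avg_comp_permEdge V G β hβ π fun x => ∏ r, centred V G β hβ (blockEdge φ r) x]
  simp only [centred, ← hπ, mean_permEdge]

lemma abs_pow_le_factorial_mul_exp (k : ℕ) (u : ℝ) :
    |u| ^ k ≤ k.factorial * (Real.exp u + Real.exp (-u)) := by
  have h := Real.pow_div_factorial_le_exp |u| (abs_nonneg u) k
  have hk : (0 : ℝ) < k.factorial := by exact_mod_cast k.factorial_pos
  rw [div_le_iff₀ hk, mul_comm] at h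
  refine h.trans (mul_le_mul_of_nonneg_left ?_ hk.le)
  rcases abs_choice u with hu | hu <;> rw [hu] <;> linarith [Real.exp_pos u, Real.exp_pos (-u)]

lemma abs_prod_le_sum_abs_pow {κ : Type*} [Fintype κ] [Nonempty κ] (S : κ → ℝ) :
    |∏ r, S r| ≤ ∑ r, |S r| ^ Fintype.card κ := by
  obtain ⟨r₀, -, hr₀⟩ := Finset.exists_max_image Finset.univ (fun r => |S r|)
    Finset.univ_nonempty
  rw [Finset.abs_prod]
  calc ∏ r, |S r| ≤ ∏ _r : κ, |S r₀| :=
        Finset.prod_le_prod (fun _ _ => abs_nonneg _) hr₀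
    _ = |S r₀| ^ Fintype.card κ := by rw [Finset.prod_const, Finset.card_univ]
    _ ≤ _ := Finset.single_le_sum (f := fun r => |S r| ^ Fintype.card κ)
        (fun r _ => pow_nonneg (abs_nonneg _) _) (Finset.mem_univ r₀)

/-- Joint centred moments of `k` vertex-disjoint edges are of order `n^{-k/2}`. -/
lemma Subcritical.abs_avg_prod_centred_le {p : ℝ} (hsub : Subcritical V G β p)
    (κ : Type*) [Fintype κ] :
    ∃ C : ℝ, 0 ≤ C ∧ ∃ N : ℕ, ∀ n, N ≤ n → ∀ i : κ → EdgeSet n,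
      (∀ r r', r ≠ r' → ¬ ShareVertex (i r) (i r')) →
        |avg ((ergmEnergy V G β hβ n).weight 0) fun x => ∏ r, centred V G β hβ (i r) x| ≤
          C * ((√(n : ℝ))⁻¹) ^ Fintype.card κ := by
  classical
  rcases isEmpty_or_nonempty κ with hκ | hκ
  · refine ⟨1, zero_le_one, 0, fun n _ i _ => ?_⟩
    simp [avg_const (Energy.weight_pos _ _)]
  obtain ⟨C, N, hC⟩ := Subcritical.avg_exp_sum_le V G β hβ hsub
  set k := Fintype.card κ with hk
  have hk0 : 0 < k := Fintype.card_pos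
  set C' := k * (k.factorial * (2 * |C|)) with hC'
  refine ⟨(4 * k : ℝ) ^ k * C', by positivity, max N (2 * k), fun n hn i hi => ?_⟩
  have hnN : N ≤ n := (le_max_left _ _).trans hn
  have hnk : 2 * k ≤ n := (le_max_right _ _).trans hn
  have hn0 : (0 : ℝ) < n := by exact_mod_cast (by omega : 0 < n)
  have hsq : 0 < √(n : ℝ) := Real.sqrt_pos.2 hn0
  obtain ⟨φ, hφ⟩ := exists_blockEdge_eq hi
  set w := (ergmEnergy V G β hβ n).weight 0 with hw
  have hw0 : ∀ x, 0 < w x := Energy.weight_pos _ _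
  set B := n / (2 * k) with hB
  have hBn : B * (2 * k) ≤ n := Nat.div_mul_le_self _ _
  obtain ⟨Θ⟩ : Nonempty ((κ × Fin B) × Bool ↪ Fin n) := by
    refine Function.Embedding.nonempty_of_card_le ?_
    simp only [Fintype.card_prod, Fintype.card_fin, Fintype.card_bool, ← hk]
    linarith
  set Q := avg w fun x => ∏ r, centred V G β hβ (i r) x with hQ
  set S : κ → Config n → ℝ := fun r x => ∑ b, centred V G β hβ (blockEdge Θ (r, b)) x with hS
  have hfactor : (avg w fun x => ∏ r, S r x) = (B : ℝ) ^ k * Q := by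
    simp only [hS, Finset.prod_univ_sum]
    rw [avg_sum]
    have : ∀ q ∈ Fintype.piFinset fun _ : κ => (Finset.univ : Finset (Fin B)),
        (avg w fun x => ∏ r, centred V G β hβ (blockEdge Θ (r, q r)) x) = Q := by
      intro q _
      let φ' : κ × Bool ↪ Fin n := ⟨fun t => Θ ((t.1, q t.1), t.2), fun t t' h => by
        have := Θ.injective h
        simp only [Prod.mk.injEq] at this
        exact Prod.ext this.1.1 this.2⟩
      simp only [hQ, hφ]
      exact avg_prod_centred_blockEdge V G β hβ φ φ'
    rw [Finset.sum_congr rfl this, Finset.sum_const, Fintype.card_piFinset]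
    simp [hk]
  have hexp : ∀ r (t : ℝ), |t| = (√(n : ℝ))⁻¹ →
      avg w (fun x => Real.exp (t * S r x)) ≤ |C| := by
    intro r t ht
    have hinj : Function.Injective fun b => blockEdge Θ (r, b) := fun b b' h => by
      simpa using blockEdge_injective Θ h
    have h := hC n hnN (Finset.univ.map ⟨_, hinj⟩) (by
      rw [Finset.card_map, Finset.card_univ, Fintype.card_fin]
      exact Nat.div_le_self _ _) t ht
    simp only [Finset.sum_map, Function.Embedding.coeFn_mk] at h
    exact h.trans (le_abs_self C)
  have hmom : ∀ r, avg w (fun x => |S r x| ^ k) ≤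
      √(n : ℝ) ^ k * (k.factorial * (2 * |C|)) := by
    intro r
    set t := (√(n : ℝ))⁻¹ with ht
    have ht0 : 0 < t := inv_pos.2 hsq
    have h1 : ∀ x, |S r x| ^ k ≤ (√(n : ℝ) ^ k * k.factorial) *
        (Real.exp (t * S r x) + Real.exp (-t * S r x)) := by
      intro x
      have h2 : |S r x| = √(n : ℝ) * |t * S r x| := by
        rw [abs_mul, abs_of_pos ht0, ht, mul_inv_cancel_left₀ hsq.ne']
      rw [h2, mul_pow, mul_assoc, neg_mul]
      exact mul_le_mul_of_nonneg_left (abs_pow_le_factorial_mul_exp k _) (by positivity)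
    refine (avg_mono hw0 h1).trans ?_
    rw [avg_const_mul, avg_add, mul_assoc]
    have h3 := hexp r t (abs_of_pos ht0)
    have h4 := hexp r (-t) (by rw [abs_neg, abs_of_pos ht0])
    gcongr
    linarith
  have hbound : (B : ℝ) ^ k * |Q| ≤ √(n : ℝ) ^ k * C' := by
    have h1 : (B : ℝ) ^ k * |Q| = |avg w fun x => ∏ r, S r x| := by
      rw [hfactor, abs_mul, abs_of_nonneg (by positivity : (0 : ℝ) ≤ (B : ℝ) ^ k)]
    rw [h1]
    refine (abs_avg_le hw0).trans ((avg_mono hw0 fun x =>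
      abs_prod_le_sum_abs_pow fun r => S r x).trans ?_)
    rw [avg_sum]
    refine (Finset.sum_le_sum fun r _ => hmom r).trans (le_of_eq ?_)
    rw [Finset.sum_const, Finset.card_univ, nsmul_eq_mul, hC']
    ring
  have hBlow : (n : ℝ) ≤ 4 * k * B := by
    have h1 : n < (B + 1) * (2 * k) := by
      rw [mul_comm]; exact Nat.lt_mul_div_succ n (by omega)
    have h2 : 1 ≤ B := (Nat.one_le_div_iff (by omega)).2 hnk
    have h3 : n ≤ 4 * k * B := by nlinarith
    exact_mod_cast h3
  have hn2 : (n : ℝ) = √(n : ℝ) * √(n : ℝ) := (Real.mul_self_sqrt hn0.le).symm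
  rw [inv_pow, ← div_eq_mul_inv, le_div_iff₀ (by positivity)]
  have h5 : √(n : ℝ) ^ k * (|Q| * √(n : ℝ) ^ k) ≤ √(n : ℝ) ^ k * ((4 * k : ℝ) ^ k * C') := by
    calc √(n : ℝ) ^ k * (|Q| * √(n : ℝ) ^ k) = (n : ℝ) ^ k * |Q| := by
          nth_rewrite 3 [hn2]; rw [mul_pow]; ring
      _ ≤ (4 * k * B : ℝ) ^ k * |Q| := by gcongr
      _ = (4 * k : ℝ) ^ k * ((B : ℝ) ^ k * |Q|) := by rw [mul_pow]; ring
      _ ≤ (4 * k : ℝ) ^ k * (√(n : ℝ) ^ k * C') := by gcongr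
      _ = _ := by ring
  exact le_of_mul_le_mul_left h5 (by positivity)

end Moments

section FiniteEnergy

/-- The indicator of `c = b`. -/
noncomputable def hit (b c : Bool) : ℝ := if c = b then 1 else 0

lemma hit_nonneg (b c : Bool) : 0 ≤ hit b c := by
  unfold hit
  split_ifs <;> norm_num

variable {E I : Type*} [Fintype I] [DecidableEq E] [Fintype E] {D : Energy E I}

lemma Energy.Sparse.pow_le_avg_prod_hit {d : ℕ} {K ν : ℝ} (hD : D.Sparse d K ν) {ι : Type*}
    {j : ι → E} (hj : Function.Injective j) (b : ι → Bool) (T : Finset ι) :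
    (1 - Phi K) ^ #T ≤ avg (D.weight 0) fun x => ∏ t ∈ T, hit (b t) (x (j t)) := by
  classical
  induction T using Finset.induction_on with
  | empty => simp [avg_const (D.weight_pos 0)]
  | insert t T ht ih =>
    rw [Finset.card_insert_of_notMem ht, pow_succ', D.avg_gibbs 0 (j t)]
    refine (mul_le_mul_of_nonneg_left ih (sub_nonneg.2 (Phi_lt_one K).le)).trans ?_
    rw [← avg_const_mul]
    refine avg_mono (D.weight_pos 0) fun x => ?_
    have hP : ∀ c, ∏ u ∈ T, hit (b u) (Function.update x (j t) c (j u)) =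
        ∏ u ∈ T, hit (b u) (x (j u)) := fun c => Finset.prod_congr rfl fun u hu => by
      rw [Function.update_of_ne (hj.ne (ne_of_mem_of_not_mem hu ht))]
    simp only [Finset.prod_insert ht, hP, Function.update_self]
    have hP0 : 0 ≤ ∏ u ∈ T, hit (b u) (x (j u)) := Finset.prod_nonneg fun _ _ => hit_nonneg _ _
    have hup : D.rate 0 (j t) x ≤ Phi K := by
      unfold rate
      refine Phi_mono ?_
      simpa using hD.slope_le (j t) x
    have hlow : 1 / 2 ≤ D.rate 0 (j t) x := by
      have h0 : Phi 0 = 1 / 2 := by norm_num [Phi]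
      rw [← h0]
      refine Phi_mono ?_
      simpa using D.slope_nonneg (j t) x
    generalize ∏ u ∈ T, hit (b u) (x (j u)) = P at hP0 ⊢
    cases b t
    · simp only [hit, Bool.true_eq_false, if_false, if_true]
      nlinarith
    · simp only [hit, Bool.false_eq_true, if_false, if_true]
      nlinarith

end FiniteEnergy

section Conditional

variable {s : ℕ} (V : Fin s → ℕ) (G : ∀ i, SimpleGraph (Fin (V i))) (β : Fin s → ℝ)
  (hβ : ∀ i, 0 < β i)

lemma shareVertex_self {n : ℕ} (e : EdgeSet n) : ShareVertex e e := by
  obtain ⟨a, b, h, rfl⟩ := exists_eq_mkEdge e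
  exact ⟨a, Sym2.mem_mk_left _ _, Sym2.mem_mk_left _ _⟩

/-- Averages of products of affine functions of vertex-disjoint edges, where the factors
indexed by `R` are centred. -/
lemma Subcritical.abs_avg_prod_affine_le {p : ℝ} (hsub : Subcritical V G β p)
    (Q : Type*) [Fintype Q] :
    ∃ C : ℝ, 0 ≤ C ∧ ∃ N : ℕ, ∀ n, N ≤ n → ∀ i : Q → EdgeSet n,
      (∀ q q', q ≠ q' → ¬ ShareVertex (i q) (i q')) → ∀ c d : Q → ℝ, (∀ q, |c q| ≤ 3) →
        (∀ q, |d q| ≤ 3) → ∀ R : Finset Q, (∀ q ∈ R, c q = 0) →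
        |avg ((ergmEnergy V G β hβ n).weight 0) fun x =>
          ∏ q, (d q * centred V G β hβ (i q) x + c q)| ≤ C * ((√(n : ℝ))⁻¹) ^ #R := by
  classical
  choose C hC0 N hN using fun S : Finset Q =>
    Subcritical.abs_avg_prod_centred_le V G β hβ hsub S
  refine ⟨∑ S, 3 ^ Fintype.card Q * C S, Finset.sum_nonneg fun S _ =>
    mul_nonneg (by positivity) (hC0 S), max 1 (Finset.univ.sup N), ?_⟩
  intro n hn i hi c d hc hd R hR
  have hn1 : (1 : ℝ) ≤ n := by exact_mod_cast (le_max_left _ _).trans hn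
  have hsq : 1 ≤ √(n : ℝ) := Real.one_le_sqrt.2 hn1
  set w := (ergmEnergy V G β hβ n).weight 0 with hw
  simp only [Finset.prod_add]
  rw [avg_sum, Finset.powerset_univ, Finset.sum_mul]
  refine (Finset.abs_sum_le_sum_abs _ _).trans (Finset.sum_le_sum fun S _ => ?_)
  have hsplit : (avg w fun x => (∏ q ∈ S, d q * centred V G β hβ (i q) x) *
      ∏ q ∈ Finset.univ \ S, c q) = ((∏ q ∈ S, d q) * ∏ q ∈ Finset.univ \ S, c q) *
        avg w fun x => ∏ q : S, centred V G β hβ (i q) x := by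
    rw [← avg_const_mul]
    congr 1
    funext x
    rw [Finset.prod_mul_distrib,
      Finset.prod_coe_sort S fun q => centred V G β hβ (i q) x]
    ring
  rw [hsplit]
  by_cases hRS : R ⊆ S
  · have h1 := hN S n ((Finset.le_sup (Finset.mem_univ S)).trans ((le_max_right _ _).trans hn))
      (fun q => i q) fun q q' h => hi _ _ fun h' => h (Subtype.ext h')
    have h2 : |(∏ q ∈ S, d q) * ∏ q ∈ Finset.univ \ S, c q| ≤ 3 ^ Fintype.card Q := by
      rw [abs_mul, Finset.abs_prod, Finset.abs_prod]
      have hS : #S + #(Finset.univ \ S) = Fintype.card Q := by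
        rw [← Finset.card_univ, ← Finset.card_sdiff_add_card_eq_card (Finset.subset_univ S),
          add_comm]
      rw [← hS, pow_add, ← Finset.prod_const, ← Finset.prod_const]
      exact mul_le_mul (Finset.prod_le_prod (fun _ _ => abs_nonneg _) fun q _ => hd q)
        (Finset.prod_le_prod (fun _ _ => abs_nonneg _) fun q _ => hc q)
        (Finset.prod_nonneg fun _ _ => abs_nonneg _)
        (Finset.prod_nonneg fun _ _ => by norm_num)
    have h3 : ((√(n : ℝ))⁻¹) ^ #S ≤ ((√(n : ℝ))⁻¹) ^ #R :=
      pow_le_pow_of_le_one (by positivity) (inv_le_one_of_one_le₀ hsq) (Finset.card_le_card hRS)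
    rw [abs_mul, mul_assoc]
    refine mul_le_mul h2 (h1.trans ?_) (abs_nonneg _) (by positivity)
    rw [Fintype.card_coe]
    exact mul_le_mul_of_nonneg_left h3 (hC0 S)
  · obtain ⟨q, hqR, hqS⟩ := Finset.not_subset.1 hRS
    have : ∏ q ∈ Finset.univ \ S, c q = 0 :=
      Finset.prod_eq_zero (Finset.mem_sdiff.2 ⟨Finset.mem_univ q, hqS⟩) (hR q hqR)
    rw [this, mul_zero, zero_mul, abs_zero]
    exact mul_nonneg (mul_nonneg (by positivity) (hC0 S)) (by positivity)

lemma condExpect_ergmProb {n l : ℕ} (F : Config n → ℝ) (j : Fin l → EdgeSet n)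
    (b : Fin l → Bool) :
    condExpect (ergmProb V G β) F j b =
      (avg ((ergmEnergy V G β hβ n).weight 0) fun x => F x * ∏ t, hit (b t) (x (j t))) /
        avg ((ergmEnergy V G β hβ n).weight 0) fun x => ∏ t, hit (b t) (x (j t)) := by
  classical
  have hprod : ∀ x : Config n, ∏ t, hit (b t) (x (j t)) =
      if ∀ t, x (j t) = b t then 1 else 0 := by
    intro x
    split_ifs with h
    · exact Finset.prod_eq_one fun t _ => if_pos (h t)
    · push Not at h
      obtain ⟨t, ht⟩ := h
      exact Finset.prod_eq_zero (Finset.mem_univ t) (if_neg ht)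
  unfold condExpect prob
  rw [← expect_ergmProb V G β hβ, ← expect_ergmProb V G β hβ]
  unfold expect
  simp only [hprod, mul_ite, mul_one, mul_zero]
  congr!

/-- A power of a centred Bernoulli variable is affine in the variable. -/
lemma pow_sub_eq_affine (μ : ℝ) (a : ℕ) (c : Bool) :
    (ind c - μ) ^ a = ((1 - μ) ^ a - (-μ) ^ a) * (ind c - μ) +
      ((-μ) ^ a + ((1 - μ) ^ a - (-μ) ^ a) * μ) := by
  cases c
  · rw [ind_false, zero_sub]; ring
  · rw [ind_true]; ring

lemma hit_eq_affine (μ : ℝ) (b c : Bool) :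
    hit b c = (if b = true then 1 else -1) * (ind c - μ) +
      (if b = true then μ else 1 - μ) := by
  cases b <;> cases c <;> simp [hit, ind]

end Conditional

/-- **(Proposition 5.2, conditional moment bounds).**
For fixed `l, m ≥ 0` and exponents `a_r ≥ 1` with `Σ a_r ≤ 2m`, there is a constant
`C > 0` such that for all large `n`, all families of pairwise vertex-disjoint edges
`i_1, …, i_m, j_1, …, j_l`, and every realization `b` of the conditioned coordinates,
`|𝔼[Π_r (X_{i_r} - 𝔼X_{i_r})^{a_r} | X_{j_1}, …, X_{j_l}]| ≤ C / n^{m - (Σ a_r)/2}`. -/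
theorem conditional_correlation_bound {s : ℕ} (V : Fin s → ℕ)
    (G : ∀ i, SimpleGraph (Fin (V i))) (β : Fin s → ℝ) (hβ : ∀ i, 0 < β i)
    (p : ℝ) (hsub : Subcritical V G β p)
    (l m : ℕ) (a : Fin m → ℕ) (ha1 : ∀ r, 1 ≤ a r) (ha2 : ∑ r, a r ≤ 2 * m) :
    ∃ C : ℝ, 0 < C ∧ ∃ N : ℕ, ∀ n : ℕ, N ≤ n →
      ∀ (i : Fin m → EdgeSet n) (j : Fin l → EdgeSet n),
        (∀ q q' : Fin m ⊕ Fin l, q ≠ q' →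
          ¬ ShareVertex (Sum.elim i j q) (Sum.elim i j q')) →
        ∀ b : Fin l → Bool,
          |condExpect (ergmProb V G β)
              (fun x => ∏ r : Fin m,
                (edgeX (i r) x - expect (ergmProb V G β) (edgeX (i r))) ^ a r) j b| ≤
            C / (n : ℝ) ^ ((m : ℝ) - (∑ r, (a r : ℝ)) / 2) := by
  classical
  obtain ⟨δ, K, hD⟩ := meanField_ergmEnergy V G β hβ
  obtain ⟨C, hC0, N, hN⟩ := Subcritical.abs_avg_prod_affine_le V G β hβ hsub (Fin m ⊕ Fin l)
  have hγ : 0 < 1 - Phi K := sub_pos.2 (Phi_lt_one K)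
  refine ⟨(C + 1) / (1 - Phi K) ^ l, by positivity, max 1 N, fun n hn i j hij b => ?_⟩
  have hn1 : 1 ≤ n := (le_max_left _ _).trans hn
  have hn1' : (1 : ℝ) ≤ n := by exact_mod_cast hn1
  have hn0 : (0 : ℝ) < n := by linarith
  set w := (ergmEnergy V G β hβ n).weight 0 with hw
  set μ : EdgeSet n → ℝ := fun e => avg w fun x => ind (x e) with hμ
  have hμ01 : ∀ e, μ e ∈ Set.Icc (0 : ℝ) 1 := mean_mem_Icc V G β hβ
  have hj : Function.Injective j := fun t t' h => by
    by_contra hne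
    refine hij (Sum.inr t) (Sum.inr t') (fun h' => hne (Sum.inr_injective h')) ?_
    simp only [Sum.elim_inr, h]
    exact shareVertex_self _
  have hden : (1 - Phi K) ^ l ≤ avg w fun x => ∏ t, hit (b t) (x (j t)) := by
    simpa using (hD.sparse n hn1).pow_le_avg_prod_hit hj b Finset.univ
  -- the affine representation of the factors
  set lin : Fin m → ℝ := fun r => (1 - μ (i r)) ^ a r - (-μ (i r)) ^ a r with hlin
  set d : Fin m ⊕ Fin l → ℝ := Sum.elim lin fun t => if b t = true then 1 else -1 with hd
  set c : Fin m ⊕ Fin l → ℝ := Sum.elim (fun r => (-μ (i r)) ^ a r + lin r * μ (i r))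
    fun t => if b t = true then μ (j t) else 1 - μ (j t) with hc
  have hpow : ∀ r, |(1 - μ (i r)) ^ a r| ≤ 1 ∧ |(-μ (i r)) ^ a r| ≤ 1 := fun r => by
    have h := hμ01 (i r)
    rw [abs_pow, abs_pow, abs_neg, abs_of_nonneg h.1, abs_of_nonneg (sub_nonneg.2 h.2)]
    exact ⟨pow_le_one₀ (sub_nonneg.2 h.2) (by linarith [h.1]), pow_le_one₀ h.1 h.2⟩
  have hlin2 : ∀ r, |lin r| ≤ 2 := fun r =>
    (abs_sub _ _).trans (by linarith [(hpow r).1, (hpow r).2])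
  have hd3 : ∀ q, |d q| ≤ 3 := by
    rintro (r | t)
    · exact (hlin2 r).trans (by norm_num)
    · simp only [hd, Sum.elim_inr]
      split_ifs <;> norm_num
  have hc3 : ∀ q, |c q| ≤ 3 := by
    rintro (r | t)
    · have h := hμ01 (i r)
      have h1 : |lin r * μ (i r)| ≤ 2 := by
        rw [abs_mul, abs_of_nonneg h.1]
        exact (mul_le_of_le_one_right (abs_nonneg _) h.2).trans (hlin2 r)
      exact (abs_add_le _ _).trans (by linarith [(hpow r).2])
    · have h := hμ01 (j t)
      simp only [hc, Sum.elim_inr]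
      split_ifs <;> rw [abs_le] <;> constructor <;> linarith [h.1, h.2]
  set R₀ : Finset (Fin m) := Finset.univ.filter fun r => a r = 1 with hR₀
  have hR : ∀ q ∈ R₀.map ⟨Sum.inl, Sum.inl_injective⟩, c q = 0 := by
    intro q hq
    obtain ⟨r, hr, rfl⟩ := Finset.mem_map.1 hq
    have har : a r = 1 := (Finset.mem_filter.1 hr).2
    simp [hc, hlin, har]
  have hnum := hN n ((le_max_right _ _).trans hn) (Sum.elim i j) hij c d hc3 hd3 _ hR
  rw [Finset.card_map] at hnum
  have hfac : (avg w fun x => (∏ r : Fin m,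
      (edgeX (i r) x - expect (ergmProb V G β) (edgeX (i r))) ^ a r) *
        ∏ t, hit (b t) (x (j t))) =
      avg w fun x => ∏ q, (d q * centred V G β hβ (Sum.elim i j q) x + c q) := by
    congr 1
    funext x
    rw [Fintype.prod_sum_type]
    congr 1
    · refine Finset.prod_congr rfl fun r _ => ?_
      rw [expect_ergmProb V G β hβ]
      exact pow_sub_eq_affine (μ (i r)) (a r) (x (i r))
    · exact Finset.prod_congr rfl fun t _ => hit_eq_affine (μ (j t)) (b t) (x (j t))
  have hexp : ((√(n : ℝ))⁻¹) ^ #R₀ ≤ ((n : ℝ) ^ ((m : ℝ) - (∑ r, (a r : ℝ)) / 2))⁻¹ := by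
    have hsum : (2 * m : ℝ) ≤ #R₀ + ∑ r, (a r : ℝ) := by
      have h1 : ∀ r, 2 ≤ (if a r = 1 then 1 else 0) + a r := fun r => by
        have := ha1 r
        split_ifs <;> omega
      have h2 := Finset.sum_le_sum fun r (_ : r ∈ Finset.univ) => h1 r
      rw [Finset.sum_add_distrib, ← Finset.card_filter] at h2
      simp only [Finset.sum_const, Finset.card_univ, Fintype.card_fin, smul_eq_mul] at h2
      have h3 : ((m * 2 : ℕ) : ℝ) ≤ ((#R₀ + ∑ r, a r : ℕ) : ℝ) := by exact_mod_cast h2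
      push_cast at h3
      linarith
    rw [inv_pow]
    refine inv_anti₀ (Real.rpow_pos_of_pos hn0 _) ?_
    rw [Real.sqrt_eq_rpow, ← Real.rpow_natCast, ← Real.rpow_mul hn0.le]
    exact Real.rpow_le_rpow_of_exponent_le hn1' (by linarith)
  rw [condExpect_ergmProb V G β hβ, hfac, abs_div,
    abs_of_nonneg ((pow_pos hγ l).le.trans hden), div_div, mul_comm, ← div_div]
  refine div_le_div₀ (by positivity) (hnum.trans ?_) (pow_pos hγ l) hden
  rw [div_eq_mul_inv]
  exact mul_le_mul (by linarith) hexp (by positivity) (by linarith)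

end ERGM
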